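/- For any embedding of the complete graph K₆ into ℝ³, there exist two disjoint 3-cycles of K₆ whose images have odd linking number (Conway–Gordon–Sachs theorem). -/

import Mathlib

open Set

noncomputable section

/-- The point of `ℝ^V` corresponding to a vertex `v` of a graph. -/
def vert {V : Type*} [DecidableEq V] (v : V) : V → ℝ := fun i => if i = v then 1 else 0

/-- Geometric realization of a simple graph as a subset of `ℝ^V`:
the union of the straight segments joining the standard points of adjacent vertices. -/
def graphRealization {V : Type*} [DecidableEq V] (G : SimpleGraph V) : Set (V → ℝ) :=
  ⋃ p : {p : V × V // G.Adj p.1 p.2}, segment ℝ (vert p.1.1) (vert p.1.2)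

/-- A (compact) polyhedron: a finite union of polytopes (convex hulls of finite sets). -/
def IsPolyhedron {E : Type*} [AddCommGroup E] [Module ℝ E] (s : Set E) : Prop :=
  ∃ T : Set (Set E), T.Finite ∧ (∀ P ∈ T, ∃ Q : Set E, Q.Finite ∧ P = convexHull ℝ Q) ∧
    s = ⋃₀ T

/-- `f` is piecewise linear (PL) on `s`: there is a finite family of polytopes covering `s`
on each of which `f` coincides with an affine map. -/
def IsPLOn {E F : Type*} [AddCommGroup E] [Module ℝ E] [AddCommGroup F] [Module ℝ F]
    (f : E → F) (s : Set E) : Prop :=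
  ∃ T : Set (Set E), T.Finite ∧ (∀ P ∈ T, ∃ Q : Set E, Q.Finite ∧ P = convexHull ℝ Q) ∧
    s ⊆ ⋃₀ T ∧ ∀ P ∈ T, ∃ g : E →ᵃ[ℝ] F, EqOn f g (P ∩ s)

/-- The cone over a set `A` with apex `p` (union of segments from `p` to points of `A`). -/
def coneFrom {E : Type*} [AddCommGroup E] [Module ℝ E] (p : E) (A : Set E) : Set E :=
  ⋃ x ∈ A, segment ℝ p x

/-- Mod 2 linking of two disjoint closed curves `A`, `B` in `ℝ³`: for a dense (hence generic)
set of apexes `p`, the 2-chain `coneFrom p A` bounding `A` meets `B` in an odd finite number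
of points.  For PL curves in general position this is the mod 2 linking number being 1. -/
def LinkedMod2Curves (A B : Set (Fin 3 → ℝ)) : Prop :=
  Dense {p : Fin 3 → ℝ | (coneFrom p A ∩ B).Finite ∧ Odd (coneFrom p A ∩ B).ncard}

/-- The triangle (3-cycle) on vertices `u, v, w` inside the realization of a graph. -/
def triangleSet {V : Type*} [DecidableEq V] (u v w : V) : Set (V → ℝ) :=
  segment ℝ (vert u) (vert v) ∪ segment ℝ (vert v) (vert w) ∪ segment ℝ (vert w) (vert u)

/-- The orientation determinant of four points of `ℝ³`. -/
def orient (a b c d : Fin 3 → ℝ) : ℝ :=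
  (b 0 - a 0) * ((c 1 - a 1) * (d 2 - a 2) - (c 2 - a 2) * (d 1 - a 1)) -
  (b 1 - a 1) * ((c 0 - a 0) * (d 2 - a 2) - (c 2 - a 2) * (d 0 - a 0)) +
  (b 2 - a 2) * ((c 0 - a 0) * (d 1 - a 1) - (c 1 - a 1) * (d 0 - a 0))

/-- Whether four points are negatively oriented. -/
def negOrient (a b c d : Fin 3 → ℝ) : Bool := decide (orient a b c d < 0)

/-- The value in `ZMod 2` of a Boolean. -/
def bit (b : Bool) : ZMod 2 := if b then 1 else 0

/-- The restriction that a three-term Grassmann–Plücker relation `x - y + z = 0` puts on the signs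
of its terms. -/
def SignRel (x y z : Bool) : Prop := x = z → x = y

instance (x y z : Bool) : Decidable (SignRel x y z) := inferInstanceAs (Decidable (x = z → x = y))

/-- The condition on orientations for a segment to cross a triangle: its ends lie on different
sides of the plane of the triangle, and its line passes the three sides in the same sense. -/
def crossSign (x y u v w : Bool) : Bool := x != y && (u == v && v == w)

/-- Whether the triangle `a b c` is crossed by the segment `x y`, as an element of `ZMod 2`,
for points in general position. -/
def triCross (a b c x y : Fin 3 → ℝ) : ZMod 2 :=
  bit (crossSign (negOrient a b c x) (negOrient a b c y)
    (negOrient a b x y) (negOrient b c x y) (negOrient c a x y))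

/-- A family of points of `ℝ³` no four of which are coplanar. -/
def GenPos {ι : Type*} (P : ι → Fin 3 → ℝ) : Prop :=
  ∀ i j k l, [i, j, k, l].Nodup → orient (P i) (P j) (P k) (P l) ≠ 0

theorem negOrient_eq_not {a b c d a' b' c' d' : Fin 3 → ℝ} (h0 : orient a' b' c' d' ≠ 0)
    (h : orient a b c d = -orient a' b' c' d') : negOrient a b c d = !negOrient a' b' c' d' := by
  rcases lt_or_gt_of_ne h0 with h1 | h1
  · have h2 : ¬ orient a b c d < 0 := by linarith
    simp [negOrient, h1, h2]
  · have h2 : orient a b c d < 0 := by linarith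
    have h3 : ¬ orient a' b' c' d' < 0 := by linarith
    simp [negOrient, h2, h3]

theorem negOrient_congr {a b c d a' b' c' d' : Fin 3 → ℝ}
    (h : orient a b c d = orient a' b' c' d') : negOrient a b c d = negOrient a' b' c' d' := by
  simp [negOrient, h]

theorem decide_neg_mul {x y : ℝ} (hx : x ≠ 0) (hy : y ≠ 0) :
    (decide (x < 0) ^^ decide (y < 0)) = decide (x * y < 0) := by
  rcases lt_or_gt_of_ne hx with h1 | h1 <;> rcases lt_or_gt_of_ne hy with h2 | h2 <;>
    simp [mul_neg_iff, h1, h2, not_lt_of_gt]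

theorem signRel_of_eq {x₁ x₂ y₁ y₂ z₁ z₂ : ℝ} (hx₁ : x₁ ≠ 0) (hx₂ : x₂ ≠ 0) (hy₁ : y₁ ≠ 0)
    (hy₂ : y₂ ≠ 0) (hz₁ : z₁ ≠ 0) (hz₂ : z₂ ≠ 0) (h : x₁ * x₂ - y₁ * y₂ + z₁ * z₂ = 0) :
    SignRel (decide (x₁ < 0) ^^ decide (x₂ < 0)) (decide (y₁ < 0) ^^ decide (y₂ < 0))
      (decide (z₁ < 0) ^^ decide (z₂ < 0)) := by
  rw [decide_neg_mul hx₁ hx₂, decide_neg_mul hy₁ hy₂, decide_neg_mul hz₁ hz₂]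
  have := mul_ne_zero hx₁ hx₂
  have := mul_ne_zero hz₁ hz₂
  intro hxz
  rw [decide_eq_decide] at hxz ⊢
  grind

/-- The number modulo 2 of crossings of the two segments `a b` and `c d` seen from `p`. -/
def viewCross (p a b c d : Fin 3 → ℝ) : ZMod 2 := triCross p a b c d + triCross p c d a b

/-- The number modulo 2 of pairs of opposite sides of a tetrahedron that cross as seen from
a point, in terms of the orientations of its faces with that point. -/
def quadSign (x y z w : Bool) : ZMod 2 :=
  bit ((x == y && z == w) || (x != y && y == z && x == w))

set_option synthInstance.maxHeartbeats 400000 in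
set_option synthInstance.maxSize 2000 in
set_option maxRecDepth 10000 in
/-- The sign-vector form of the symmetry of triangle intersections; `o` with four indices stands
for the orientation of the corresponding four points among six. -/
theorem two_triangles_bool :
    ∀ o0123 o0124 o0125 o0134 o0135 o0145 : Bool,
    SignRel (o0123 ^^ o0145) (o0124 ^^ o0135) (o0125 ^^ o0134) →
    ∀ o0234 o0235 o0245 : Bool,
    SignRel (o0123 ^^ o0245) (o0124 ^^ o0235) (o0125 ^^ o0234) →
    ∀ o1234 o1235 o1245 : Bool,
    SignRel (o0123 ^^ o1245) (o0124 ^^ o1235) (o0125 ^^ o1234) →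
    ∀ o0345 o1345 o2345 : Bool,
    SignRel (o0134 ^^ o2345) (o0234 ^^ o1345) (o0345 ^^ o1234) →
    SignRel (o0135 ^^ o2345) (o0235 ^^ o1345) (o0345 ^^ o1235) →
    SignRel (o0145 ^^ o2345) (o0245 ^^ o1345) (o0345 ^^ o1245) →
    bit (crossSign o0124 o0125 o0145 o1245 !o0245) +
      bit (crossSign o0123 o0124 o0134 o1234 !o0234) +
      bit (crossSign o0123 o0125 o0135 o1235 !o0235) =
    bit (crossSign (!o1345) (!o2345) o1234 o1245 !o1235) +
      bit (crossSign (!o0345) (!o1345) o0134 o0145 !o0135) +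
      bit (crossSign (!o0345) (!o2345) o0234 o0245 !o0235) := by
  decide +kernel

theorem two_triangles {ι : Type*} {P : ι → Fin 3 → ℝ} (hP : GenPos P) {p a b r c d : ι}
    (hd : [p, a, b, r, c, d].Nodup) :
    triCross (P p) (P a) (P b) (P c) (P d) + triCross (P p) (P a) (P b) (P r) (P c) +
      triCross (P p) (P a) (P b) (P r) (P d) =
    triCross (P r) (P c) (P d) (P a) (P b) + triCross (P r) (P c) (P d) (P p) (P a) +
      triCross (P r) (P c) (P d) (P p) (P b) := by
  simp only [List.nodup_cons, List.mem_cons, List.not_mem_nil, not_or, or_false] at hd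
  have hne : ∀ i j k l, [i, j, k, l].Nodup → orient (P i) (P j) (P k) (P l) ≠ 0 := hP
  simp only [List.nodup_cons, List.mem_cons, List.not_mem_nil, not_or, or_false] at hne
  have h0123 := hne p a b r (by tauto)
  have h0124 := hne p a b c (by tauto)
  have h0125 := hne p a b d (by tauto)
  have h0134 := hne p a r c (by tauto)
  have h0135 := hne p a r d (by tauto)
  have h0145 := hne p a c d (by tauto)
  have h0234 := hne p b r c (by tauto)
  have h0235 := hne p b r d (by tauto)
  have h0245 := hne p b c d (by tauto)
  have h0345 := hne p r c d (by tauto)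
  have h1234 := hne a b r c (by tauto)
  have h1235 := hne a b r d (by tauto)
  have h1245 := hne a b c d (by tauto)
  have h1345 := hne a r c d (by tauto)
  have h2345 := hne b r c d (by tauto)
  generalize P p = p, P a = a, P b = b, P r = r, P c = c, P d = d at *
  have e2045 : negOrient b p c d = !negOrient p b c d :=
    negOrient_eq_not h0245 (by simp only [orient]; ring)
  have e2034 : negOrient b p r c = !negOrient p b r c :=
    negOrient_eq_not h0234 (by simp only [orient]; ring)
  have e2035 : negOrient b p r d = !negOrient p b r d :=
    negOrient_eq_not h0235 (by simp only [orient]; ring)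
  have e3451 : negOrient r c d a = !negOrient a r c d :=
    negOrient_eq_not h1345 (by simp only [orient]; ring)
  have e3452 : negOrient r c d b = !negOrient b r c d :=
    negOrient_eq_not h2345 (by simp only [orient]; ring)
  have e3412 : negOrient r c a b = negOrient a b r c :=
    negOrient_congr (by simp only [orient]; ring)
  have e4512 : negOrient c d a b = negOrient a b c d :=
    negOrient_congr (by simp only [orient]; ring)
  have e5312 : negOrient d r a b = !negOrient a b r d :=
    negOrient_eq_not h1235 (by simp only [orient]; ring)
  have e3450 : negOrient r c d p = !negOrient p r c d :=
    negOrient_eq_not h0345 (by simp only [orient]; ring)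
  have e3401 : negOrient r c p a = negOrient p a r c :=
    negOrient_congr (by simp only [orient]; ring)
  have e4501 : negOrient c d p a = negOrient p a c d :=
    negOrient_congr (by simp only [orient]; ring)
  have e5301 : negOrient d r p a = !negOrient p a r d :=
    negOrient_eq_not h0135 (by simp only [orient]; ring)
  have e3402 : negOrient r c p b = negOrient p b r c :=
    negOrient_congr (by simp only [orient]; ring)
  have e4502 : negOrient c d p b = negOrient p b c d :=
    negOrient_congr (by simp only [orient]; ring)
  have e5302 : negOrient d r p b = !negOrient p b r d :=
    negOrient_eq_not h0235 (by simp only [orient]; ring)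
  simp only [triCross, e2045, e2034, e2035, e3451, e3452, e3412, e4512, e5312, e3450,
    e3401, e4501, e5301, e3402, e4502, e5302]
  exact two_triangles_bool
    _ _ _ _ _ _
    (signRel_of_eq h0123 h0145 h0124 h0135 h0125 h0134 (by simp only [orient]; ring))
    _ _ _
    (signRel_of_eq h0123 h0245 h0124 h0235 h0125 h0234 (by simp only [orient]; ring))
    _ _ _
    (signRel_of_eq h0123 h1245 h0124 h1235 h0125 h1234 (by simp only [orient]; ring))
    _ _ _
    (signRel_of_eq h0134 h2345 h0234 h1345 h0345 h1234 (by simp only [orient]; ring))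
    (signRel_of_eq h0135 h2345 h0235 h1345 h0345 h1235 (by simp only [orient]; ring))
    (signRel_of_eq h0145 h2345 h0245 h1345 h0345 h1245 (by simp only [orient]; ring))

theorem five_points_bool :
    ∀ o123 o124 o125 o134 o135 o145 : Bool,
    SignRel (o123 ^^ o145) (o124 ^^ o135) (o125 ^^ o134) → ∀ o234 o235 o245 : Bool,
    SignRel (o123 ^^ o245) (o124 ^^ o235) (o125 ^^ o234) → ∀ o345 : Bool,
    SignRel (o123 ^^ o345) (o134 ^^ o235) (o135 ^^ o234) →
    SignRel (o124 ^^ o345) (o134 ^^ o245) (o145 ^^ o234) →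
    SignRel (o125 ^^ o345) (o135 ^^ o245) (o145 ^^ o235) →
    quadSign o123 o124 o134 o234 + quadSign o123 o125 o135 o235 + quadSign o124 o125 o145 o245 +
      quadSign o134 o135 o145 o345 + quadSign o234 o235 o245 o345 = 1 := by
  decide +kernel

theorem quadSign_eq {ι : Type*} {P : ι → Fin 3 → ℝ} (hP : GenPos P) {p a b c d : ι}
    (hd : [p, a, b, c, d].Nodup) :
    viewCross (P p) (P a) (P b) (P c) (P d) + viewCross (P p) (P a) (P c) (P b) (P d) +
      viewCross (P p) (P a) (P d) (P b) (P c) =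
    quadSign (negOrient (P p) (P a) (P b) (P c)) (negOrient (P p) (P a) (P b) (P d))
      (negOrient (P p) (P a) (P c) (P d)) (negOrient (P p) (P b) (P c) (P d)) := by
  simp only [List.nodup_cons, List.mem_cons, List.not_mem_nil, not_or, or_false] at hd
  have hne : ∀ i j k l, [i, j, k, l].Nodup → orient (P i) (P j) (P k) (P l) ≠ 0 := hP
  simp only [List.nodup_cons, List.mem_cons, List.not_mem_nil, not_or, or_false] at hne
  have h0 := hne a b c d (by tauto)
  have h1 := hne p b c d (by tauto)
  have h2 := hne p a c d (by tauto)
  have h3 := hne p a b d (by tauto)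
  have h4 := hne p a b c (by tauto)
  clear hne hd
  generalize P p = p, P a = a, P b = b, P c = c, P d = d at *
  have e0132 : negOrient p a c b = !negOrient p a b c :=
    negOrient_eq_not h4 (by simp only [orient]; ring)
  have e0142 : negOrient p a d b = !negOrient p a b d :=
    negOrient_eq_not h3 (by simp only [orient]; ring)
  have e0143 : negOrient p a d c = !negOrient p a c d :=
    negOrient_eq_not h2 (by simp only [orient]; ring)
  have e0213 : negOrient p b a c = !negOrient p a b c :=
    negOrient_eq_not h4 (by simp only [orient]; ring)
  have e0214 : negOrient p b a d = !negOrient p a b d :=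
    negOrient_eq_not h3 (by simp only [orient]; ring)
  have e0231 : negOrient p b c a = negOrient p a b c :=
    negOrient_congr (by simp only [orient]; ring)
  have e0241 : negOrient p b d a = negOrient p a b d :=
    negOrient_congr (by simp only [orient]; ring)
  have e0243 : negOrient p b d c = !negOrient p b c d :=
    negOrient_eq_not h1 (by simp only [orient]; ring)
  have e0312 : negOrient p c a b = negOrient p a b c :=
    negOrient_congr (by simp only [orient]; ring)
  have e0341 : negOrient p c d a = negOrient p a c d :=
    negOrient_congr (by simp only [orient]; ring)
  have e0342 : negOrient p c d b = negOrient p b c d :=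
    negOrient_congr (by simp only [orient]; ring)
  have e1324 : negOrient a c b d = !negOrient a b c d :=
    negOrient_eq_not h0 (by simp only [orient]; ring)
  have e1423 : negOrient a d b c = negOrient a b c d :=
    negOrient_congr (by simp only [orient]; ring)
  have e2034 : negOrient b p c d = !negOrient p b c d :=
    negOrient_eq_not h1 (by simp only [orient]; ring)
  have e2314 : negOrient b c a d = negOrient a b c d :=
    negOrient_congr (by simp only [orient]; ring)
  have e2413 : negOrient b d a c = !negOrient a b c d :=
    negOrient_eq_not h0 (by simp only [orient]; ring)
  have e3014 : negOrient c p a d = negOrient p a c d :=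
    negOrient_congr (by simp only [orient]; ring)
  have e3024 : negOrient c p b d = negOrient p b c d :=
    negOrient_congr (by simp only [orient]; ring)
  have e3412 : negOrient c d a b = negOrient a b c d :=
    negOrient_congr (by simp only [orient]; ring)
  have e4012 : negOrient d p a b = !negOrient p a b d :=
    negOrient_eq_not h3 (by simp only [orient]; ring)
  have e4013 : negOrient d p a c = !negOrient p a c d :=
    negOrient_eq_not h2 (by simp only [orient]; ring)
  have e4023 : negOrient d p b c = !negOrient p b c d :=
    negOrient_eq_not h1 (by simp only [orient]; ring)
  simp only [viewCross, triCross,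
    e0132, e0142, e0143, e0213, e0214, e0231, e0241, e0243, e0312, e0341, e0342, e1324, e1423,
    e2034, e2314, e2413, e3014, e3024, e3412, e4012, e4013, e4023]
  generalize negOrient a b c d = x₀, negOrient p b c d = x₁, negOrient p a c d = x₂,
    negOrient p a b d = x₃, negOrient p a b c = x₄
  revert x₀ x₁ x₂ x₃ x₄
  decide

/-- The van Kampen number of `K₅` drawn with straight edges, as seen from a point, is odd. -/
theorem five_points {ι : Type*} {P : ι → Fin 3 → ℝ} (hP : GenPos P) {p a b c d e : ι}
    (hd : [p, a, b, c, d, e].Nodup) :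
    (viewCross (P p) (P a) (P b) (P c) (P d) + viewCross (P p) (P a) (P c) (P b) (P d) +
      viewCross (P p) (P a) (P d) (P b) (P c)) +
    (viewCross (P p) (P a) (P b) (P c) (P e) + viewCross (P p) (P a) (P c) (P b) (P e) +
      viewCross (P p) (P a) (P e) (P b) (P c)) +
    (viewCross (P p) (P a) (P b) (P d) (P e) + viewCross (P p) (P a) (P d) (P b) (P e) +
      viewCross (P p) (P a) (P e) (P b) (P d)) +
    (viewCross (P p) (P a) (P c) (P d) (P e) + viewCross (P p) (P a) (P d) (P c) (P e) +
      viewCross (P p) (P a) (P e) (P c) (P d)) +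
    (viewCross (P p) (P b) (P c) (P d) (P e) + viewCross (P p) (P b) (P d) (P c) (P e) +
      viewCross (P p) (P b) (P e) (P c) (P d)) = 1 := by
  simp only [List.nodup_cons, List.mem_cons, List.not_mem_nil, not_or, or_false] at hd
  have hq : ∀ p a b c d, [p, a, b, c, d].Nodup → _ := fun p a b c d h => quadSign_eq hP h
  have hne : ∀ i j k l, [i, j, k, l].Nodup → orient (P i) (P j) (P k) (P l) ≠ 0 := hP
  simp only [List.nodup_cons, List.mem_cons, List.not_mem_nil, not_or, or_false] at hne hq
  rw [hq p a b c d (by tauto), hq p a b c e (by tauto), hq p a b d e (by tauto),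
    hq p a c d e (by tauto), hq p b c d e (by tauto)]
  have h123 := hne p a b c (by tauto)
  have h124 := hne p a b d (by tauto)
  have h125 := hne p a b e (by tauto)
  have h134 := hne p a c d (by tauto)
  have h135 := hne p a c e (by tauto)
  have h145 := hne p a d e (by tauto)
  have h234 := hne p b c d (by tauto)
  have h235 := hne p b c e (by tauto)
  have h245 := hne p b d e (by tauto)
  have h345 := hne p c d e (by tauto)
  exact five_points_bool _ _ _ _ _ _
    (signRel_of_eq h123 h145 h124 h135 h125 h134 (by simp only [orient]; ring)) _ _ _
    (signRel_of_eq h123 h245 h124 h235 h125 h234 (by simp only [orient]; ring)) _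
    (signRel_of_eq h123 h345 h134 h235 h135 h234 (by simp only [orient]; ring))
    (signRel_of_eq h124 h345 h134 h245 h145 h234 (by simp only [orient]; ring))
    (signRel_of_eq h125 h345 h135 h245 h145 h235 (by simp only [orient]; ring))

/-- A 1-chain modulo 2, given by its edges, has boundary `i + j`. -/
def HasEnds {ι : Type*} (c : Multiset (ι × ι)) (i j : ι) : Prop :=
  ∀ φ : ι → ZMod 2, (c.map fun e => φ e.1 + φ e.2).sum = φ i + φ j

/-- A 1-chain modulo 2, given by its edges, has zero boundary. -/
def IsCycleChain {ι : Type*} (c : Multiset (ι × ι)) : Prop :=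
  ∀ φ : ι → ZMod 2, (c.map fun e => φ e.1 + φ e.2).sum = 0

/-- The intersection number modulo 2 of the cone from `P p` over the chain `c` with the
chain `c'`. -/
def chainCross {ι : Type*} (P : ι → Fin 3 → ℝ) (p : ι) (c c' : Multiset (ι × ι)) : ZMod 2 :=
  (c.map fun e => (c'.map fun f => triCross (P p) (P e.1) (P e.2) (P f.1) (P f.2)).sum).sum

section Chains

variable {ι : Type*} {P : ι → Fin 3 → ℝ}

theorem chainCross_add_left (p : ι) (c₁ c₂ c' : Multiset (ι × ι)) :
    chainCross P p (c₁ + c₂) c' = chainCross P p c₁ c' + chainCross P p c₂ c' := by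
  simp [chainCross]

theorem chainCross_add_right (p : ι) (c c₁ c₂ : Multiset (ι × ι)) :
    chainCross P p c (c₁ + c₂) = chainCross P p c c₁ + chainCross P p c c₂ := by
  simp [chainCross, Multiset.sum_map_add]

theorem chainCross_singleton (p a b c d : ι) :
    chainCross P p {(a, b)} {(c, d)} = triCross (P p) (P a) (P b) (P c) (P d) := by
  simp [chainCross]

theorem HasEnds.isCycleChain_add {c c' : Multiset (ι × ι)} {i j : ι} (h : HasEnds c i j)
    (h' : HasEnds c' i j) : IsCycleChain (c + c') := by
  intro φ
  rw [Multiset.map_add, Multiset.sum_add, h, h', CharTwo.add_self_eq_zero]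

theorem HasEnds.isCycleChain_triangle {c c' c'' : Multiset (ι × ι)} {i j k : ι}
    (h : HasEnds c i j) (h' : HasEnds c' j k) (h'' : HasEnds c'' i k) :
    IsCycleChain (c + c' + c'') := by
  intro φ
  rw [Multiset.map_add, Multiset.sum_add, Multiset.map_add, Multiset.sum_add, h, h', h'']
  linear_combination (φ i + φ j + φ k) * (CharTwo.two_eq_zero : (2 : ZMod 2) = 0)

theorem chainCross_swap (hP : GenPos P) {p r : ι} {c c' : Multiset (ι × ι)}
    (hc : IsCycleChain c) (hc' : IsCycleChain c')
    (hd : ∀ e ∈ c, ∀ f ∈ c', [p, e.1, e.2, r, f.1, f.2].Nodup) :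
    chainCross P p c c' = chainCross P r c' c := by
  have key : (c.map fun e => (c'.map fun f =>
      triCross (P p) (P e.1) (P e.2) (P f.1) (P f.2) +
        (triCross (P p) (P e.1) (P e.2) (P r) (P f.1) +
          triCross (P p) (P e.1) (P e.2) (P r) (P f.2))).sum).sum =
      (c.map fun e => (c'.map fun f =>
      triCross (P r) (P f.1) (P f.2) (P e.1) (P e.2) +
        (triCross (P r) (P f.1) (P f.2) (P p) (P e.1) +
          triCross (P r) (P f.1) (P f.2) (P p) (P e.2))).sum).sum := by
    refine congrArg _ (Multiset.map_congr rfl fun e he => congrArg _ (Multiset.map_congr rfl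
      fun f hf => ?_))
    rw [← add_assoc, ← add_assoc]
    exact two_triangles hP (hd e he f hf)
  rw [Multiset.sum_map_sum_map c c'] at key
  have h₁ (e : ι × ι) := hc' fun x => triCross (P p) (P e.1) (P e.2) (P r) (P x)
  have h₂ (f : ι × ι) := hc fun x => triCross (P r) (P f.1) (P f.2) (P p) (P x)
  rw [Multiset.sum_map_sum_map c' c] at key
  have key_swap : (c.map fun e => (c'.map fun f =>
      triCross (P p) (P e.1) (P e.2) (P f.1) (P f.2)).sum).sum =
      (c'.map fun f => (c.map fun e =>
      triCross (P r) (P f.1) (P f.2) (P e.1) (P e.2)).sum).sum := by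
    rw [Multiset.sum_map_sum_map c c' (f := fun e f =>
      triCross (P r) (P f.1) (P f.2) (P e.1) (P e.2) +
        (triCross (P r) (P f.1) (P f.2) (P p) (P e.1) +
          triCross (P r) (P f.1) (P f.2) (P p) (P e.2)))] at key
    simpa only [Multiset.sum_map_add, h₁, h₂, Multiset.sum_map_zero, add_zero] using key
  exact key_swap

/-- A chain joining the `i`-th and `j`-th vertices `v i`, `v j`, all of whose vertices carry
labels (by `s`) among `i`, `j`. -/
structure IsArc (s : ι → Finset (Fin 6)) (v : Fin 6 → ι) (i j : Fin 6)
    (c : Multiset (ι × ι)) : Prop where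
  hasEnds : HasEnds c (v i) (v j)
  ne : ∀ e ∈ c, e.1 ≠ e.2
  left : ∀ e ∈ c, (s e.1).Nonempty ∧ s e.1 ⊆ {i, j}
  right : ∀ e ∈ c, (s e.2).Nonempty ∧ s e.2 ⊆ {i, j}

variable {s : ι → Finset (Fin 6)} {v : Fin 6 → ι} {a : Fin 3 → ι}

theorem isArc_singleton (hv : ∀ i, s (v i) = {i}) {i j : Fin 6} (hij : i ≠ j) :
    IsArc s v i j {(v i, v j)} where
  hasEnds φ := by simp
  ne e he := by
    rw [Multiset.mem_singleton] at he
    subst he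
    exact fun h => hij (by simpa [hv] using congrArg s h)
  left e he := by simp_all
  right e he := by simp_all

theorem nodup_of_isArc (ha : Function.Injective a) (hs : ∀ n, s (a n) = ∅)
    {i j x y : Fin 6} (hd : Disjoint ({i, j} : Finset (Fin 6)) {x, y})
    {c c' : Multiset (ι × ι)} (hc : IsArc s v i j c) (hc' : IsArc s v x y c')
    {m n : Fin 3} (hmn : m ≠ n) {e f : ι × ι} (he : e ∈ c) (hf : f ∈ c') :
    [a m, e.1, e.2, a n, f.1, f.2].Nodup := by
  have key : ∀ {t u : ι}, ((s t).Nonempty ∧ s t ⊆ {i, j}) → ((s u).Nonempty ∧ s u ⊆ {x, y}) →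
      t ≠ u := by
    rintro t u ⟨⟨w, hw⟩, ht⟩ ⟨-, hu⟩ rfl
    exact Finset.disjoint_left.1 hd (ht hw) (hu hw)
  have key' : ∀ {t : ι} (n : Fin 3), (s t).Nonempty → a n ≠ t := by
    rintro _ n h rfl
    simp [hs] at h
  have e1 := hc.left e he
  have e2 := hc.right e he
  have f1 := hc'.left f hf
  have f2 := hc'.right f hf
  simp only [List.nodup_cons, List.mem_cons, List.not_mem_nil, not_or, or_false]
  exact ⟨⟨key' m e1.1, key' m e2.1, ha.ne hmn, key' m f1.1, key' m f2.1⟩,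
    ⟨hc.ne e he, (key' n e1.1).symm, key e1 f1, key e1 f2⟩,
    ⟨(key' n e2.1).symm, key e2 f1, key e2 f2⟩, ⟨key' n f1.1, key' n f2.1⟩, hc'.ne f hf,
    not_false, List.nodup_nil⟩

/-- The number modulo 2 of crossings of two chains seen from `P p`. -/
def chainView (P : ι → Fin 3 → ℝ) (p : ι) (c c' : Multiset (ι × ι)) : ZMod 2 :=
  chainCross P p c c' + chainCross P p c' c

theorem chainView_triangle_congr (hP : GenPos P) (ha : Function.Injective a)
    (hs : ∀ n, s (a n) = ∅) {i j x y z : Fin 6} (hd : [i, j, x, y, z].Nodup)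
    {c c' f₁ f₂ f₃ : Multiset (ι × ι)} (hc : IsArc s v i j c) (hc' : IsArc s v i j c')
    (h₁ : IsArc s v x y f₁) (h₂ : IsArc s v y z f₂) (h₃ : IsArc s v x z f₃) :
    chainView P (a 0) c f₁ + chainView P (a 0) c f₂ + chainView P (a 0) c f₃ =
      chainView P (a 0) c' f₁ + chainView P (a 0) c' f₂ + chainView P (a 0) c' f₃ := by
  have hD := hc.hasEnds.isCycleChain_add hc'.hasEnds
  have hT := h₁.hasEnds.isCycleChain_triangle h₂.hasEnds h₃.hasEnds
  have d₁ : Disjoint ({i, j} : Finset (Fin 6)) {x, y} := by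
    simp at hd ⊢; tauto
  have d₂ : Disjoint ({i, j} : Finset (Fin 6)) {y, z} := by
    simp at hd ⊢; tauto
  have d₃ : Disjoint ({i, j} : Finset (Fin 6)) {x, z} := by
    simp at hd ⊢; tauto
  have hN : ∀ m n, m ≠ n → ∀ e ∈ c + c', ∀ f ∈ f₁ + f₂ + f₃,
      [a m, e.1, e.2, a n, f.1, f.2].Nodup := by
    intro m n hmn e he f hf
    simp only [Multiset.mem_add] at he hf
    rcases he with he | he <;> rcases hf with (hf | hf) | hf
    · exact nodup_of_isArc ha hs d₁ hc h₁ hmn he hf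
    · exact nodup_of_isArc ha hs d₂ hc h₂ hmn he hf
    · exact nodup_of_isArc ha hs d₃ hc h₃ hmn he hf
    · exact nodup_of_isArc ha hs d₁ hc' h₁ hmn he hf
    · exact nodup_of_isArc ha hs d₂ hc' h₂ hmn he hf
    · exact nodup_of_isArc ha hs d₃ hc' h₃ hmn he hf
  have e := (chainCross_swap hP hD hT (hN 0 1 (by decide))).trans
    ((chainCross_swap hP hD hT (hN 2 1 (by decide))).symm.trans
      (chainCross_swap hP hD hT (hN 2 0 (by decide))))
  simp only [chainCross_add_left, chainCross_add_right] at e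
  simp only [chainView]
  linear_combination e + (chainCross P (a 0) f₁ c + chainCross P (a 0) f₂ c +
    chainCross P (a 0) f₃ c - chainCross P (a 0) c' f₁ - chainCross P (a 0) c' f₂ -
      chainCross P (a 0) c' f₃) * (CharTwo.two_eq_zero : (2 : ZMod 2) = 0)

/-- The closed chain formed by the arcs between three vertices. -/
def triChain (c : Fin 6 → Fin 6 → Multiset (ι × ι)) (u v w : Fin 6) : Multiset (ι × ι) :=
  c u v + c v w + c u w

theorem chainCross_triChain_apex (hP : GenPos P) (ha : Function.Injective a)
    (hs : ∀ n, s (a n) = ∅) {c : Fin 6 → Fin 6 → Multiset (ι × ι)}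
    (hc : ∀ i j, i < j → IsArc s v i j (c i j)) {i j k x y z : Fin 6} (hij : i < j) (hjk : j < k)
    (hxy : x < y) (hyz : y < z) (hd : [i, j, k, x, y, z].Nodup) :
    chainCross P (a 0) (triChain c i j k) (triChain c x y z) =
      chainCross P (a 1) (triChain c i j k) (triChain c x y z) := by
  have h₁ := hc i j hij
  have h₂ := hc j k hjk
  have h₃ := hc i k (hij.trans hjk)
  have h₁' := hc x y hxy
  have h₂' := hc y z hyz
  have h₃' := hc x z (hxy.trans hyz)
  have hD := h₁.hasEnds.isCycleChain_triangle h₂.hasEnds h₃.hasEnds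
  have hT := h₁'.hasEnds.isCycleChain_triangle h₂'.hasEnds h₃'.hasEnds
  have hN : ∀ m n, m ≠ n → ∀ e ∈ triChain c i j k, ∀ f ∈ triChain c x y z,
      [a m, e.1, e.2, a n, f.1, f.2].Nodup := by
    intro m n hmn e he f hf
    simp only [triChain, Multiset.mem_add] at he hf
    simp at hd
    rcases he with (he | he) | he <;> rcases hf with (hf | hf) | hf <;>
      refine nodup_of_isArc ha hs ?_ (hc _ _ (by omega)) (hc _ _ (by omega)) hmn he hf
    all_goals simp
    all_goals tauto
  exact (chainCross_swap hP hD hT (hN 0 2 (by decide))).trans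
    (chainCross_swap hP hD hT (hN 1 2 (by decide))).symm

/-- The van Kampen number of a drawing of `K₅`, as seen from a point, is odd. -/
theorem sum_chainView (hP : GenPos P) (ha : Function.Injective a)
    (hs : ∀ n, s (a n) = ∅) (hv : ∀ i, s (v i) = {i}) {c : Fin 6 → Fin 6 → Multiset (ι × ι)}
    (hc : ∀ i j, i < j → IsArc s v i j (c i j)) :
    chainView P (a 0) (c 1 2) (c 3 4) + chainView P (a 0) (c 1 3) (c 2 4) +
      chainView P (a 0) (c 1 4) (c 2 3) +
    chainView P (a 0) (c 1 2) (c 3 5) + chainView P (a 0) (c 1 3) (c 2 5) +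
      chainView P (a 0) (c 1 5) (c 2 3) +
    chainView P (a 0) (c 1 2) (c 4 5) + chainView P (a 0) (c 1 4) (c 2 5) +
      chainView P (a 0) (c 1 5) (c 2 4) +
    chainView P (a 0) (c 1 3) (c 4 5) + chainView P (a 0) (c 1 4) (c 3 5) +
      chainView P (a 0) (c 1 5) (c 3 4) +
    chainView P (a 0) (c 2 3) (c 4 5) + chainView P (a 0) (c 2 4) (c 3 5) +
      chainView P (a 0) (c 2 5) (c 3 4) = 1 := by
  have hvi : Function.Injective v := fun i j h => by simpa [hv] using congrArg s h
  have hav : ∀ i, a 0 ≠ v i := fun i h => by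
    have := congrArg s h
    simp [hs, hv] at this
  have hl : ∀ i j : Fin 6, i < j → IsArc s v i j {(v i, v j)} := fun i j h =>
    isArc_singleton hv h.ne
  have h12 := chainView_triangle_congr hP ha hs (by decide) (hc 1 2 (by decide))
    (hl 1 2 (by decide)) (hc 3 4 (by decide)) (hc 4 5 (by decide))
    (hc 3 5 (by decide))
  have h13 := chainView_triangle_congr hP ha hs (by decide) (hc 1 3 (by decide))
    (hl 1 3 (by decide)) (hc 2 4 (by decide)) (hc 4 5 (by decide))
    (hc 2 5 (by decide))
  have h14 := chainView_triangle_congr hP ha hs (by decide) (hc 1 4 (by decide))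
    (hl 1 4 (by decide)) (hc 2 3 (by decide)) (hc 3 5 (by decide))
    (hc 2 5 (by decide))
  have h15 := chainView_triangle_congr hP ha hs (by decide) (hc 1 5 (by decide))
    (hl 1 5 (by decide)) (hc 2 3 (by decide)) (hc 3 4 (by decide))
    (hc 2 4 (by decide))
  have h23 := chainView_triangle_congr hP ha hs (by decide) (hc 2 3 (by decide))
    (hl 2 3 (by decide)) (hl 1 4 (by decide)) (hc 4 5 (by decide))
    (hl 1 5 (by decide))
  have h24 := chainView_triangle_congr hP ha hs (by decide) (hc 2 4 (by decide))
    (hl 2 4 (by decide)) (hl 1 3 (by decide)) (hc 3 5 (by decide))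
    (hl 1 5 (by decide))
  have h25 := chainView_triangle_congr hP ha hs (by decide) (hc 2 5 (by decide))
    (hl 2 5 (by decide)) (hl 1 3 (by decide)) (hc 3 4 (by decide))
    (hl 1 4 (by decide))
  have h34 := chainView_triangle_congr hP ha hs (by decide) (hc 3 4 (by decide))
    (hl 3 4 (by decide)) (hl 1 2 (by decide)) (hl 2 5 (by decide))
    (hl 1 5 (by decide))
  have h35 := chainView_triangle_congr hP ha hs (by decide) (hc 3 5 (by decide))
    (hl 3 5 (by decide)) (hl 1 2 (by decide)) (hl 2 4 (by decide))
    (hl 1 4 (by decide))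
  have h45 := chainView_triangle_congr hP ha hs (by decide) (hc 4 5 (by decide))
    (hl 4 5 (by decide)) (hl 1 2 (by decide)) (hl 2 3 (by decide))
    (hl 1 3 (by decide))
  have h := five_points hP (p := a 0) (a := v 1) (b := v 2) (c := v 3) (d := v 4) (e := v 5)
    (by simp [hav, hvi.eq_iff])
  simp only [viewCross, ← chainCross_singleton] at h
  simp only [chainView] at *
  linear_combination h12 + h13 + h14 + h15 + h23 + h24 +
    h25 + h34 + h35 + h45 + h

theorem sum_chainCross_triChain (hP : GenPos P) (ha : Function.Injective a)
    (hs : ∀ n, s (a n) = ∅) (hv : ∀ i, s (v i) = {i}) {c : Fin 6 → Fin 6 → Multiset (ι × ι)}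
    (hc : ∀ i j, i < j → IsArc s v i j (c i j)) :
    chainCross P (a 0) (triChain c 0 1 2) (triChain c 3 4 5) +
    chainCross P (a 0) (triChain c 0 1 3) (triChain c 2 4 5) +
    chainCross P (a 0) (triChain c 0 1 4) (triChain c 2 3 5) +
    chainCross P (a 0) (triChain c 0 1 5) (triChain c 2 3 4) +
    chainCross P (a 0) (triChain c 0 2 3) (triChain c 1 4 5) +
    chainCross P (a 0) (triChain c 0 2 4) (triChain c 1 3 5) +
    chainCross P (a 0) (triChain c 0 2 5) (triChain c 1 3 4) +
    chainCross P (a 0) (triChain c 0 3 4) (triChain c 1 2 5) +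
    chainCross P (a 0) (triChain c 0 3 5) (triChain c 1 2 4) +
    chainCross P (a 0) (triChain c 0 4 5) (triChain c 1 2 3) = 1 := by
  have h := sum_chainView hP ha hs hv hc
  simp only [chainView] at h
  simp only [triChain, chainCross_add_left, chainCross_add_right]
  linear_combination h + (chainCross P (a 0) (c 0 1) (c 2 3) + chainCross P (a 0) (c 0 1) (c 2 4) +
    chainCross P (a 0) (c 0 1) (c 2 5) + chainCross P (a 0) (c 0 1) (c 3 4) +
    chainCross P (a 0) (c 0 1) (c 3 5) + chainCross P (a 0) (c 0 1) (c 4 5) +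
    chainCross P (a 0) (c 0 2) (c 1 3) + chainCross P (a 0) (c 0 2) (c 1 4) +
    chainCross P (a 0) (c 0 2) (c 1 5) + chainCross P (a 0) (c 0 2) (c 3 4) +
    chainCross P (a 0) (c 0 2) (c 3 5) + chainCross P (a 0) (c 0 2) (c 4 5) +
    chainCross P (a 0) (c 0 3) (c 1 2) + chainCross P (a 0) (c 0 3) (c 1 4) +
    chainCross P (a 0) (c 0 3) (c 1 5) + chainCross P (a 0) (c 0 3) (c 2 4) +
    chainCross P (a 0) (c 0 3) (c 2 5) + chainCross P (a 0) (c 0 3) (c 4 5) +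
    chainCross P (a 0) (c 0 4) (c 1 2) + chainCross P (a 0) (c 0 4) (c 1 3) +
    chainCross P (a 0) (c 0 4) (c 1 5) + chainCross P (a 0) (c 0 4) (c 2 3) +
    chainCross P (a 0) (c 0 4) (c 2 5) + chainCross P (a 0) (c 0 4) (c 3 5) +
    chainCross P (a 0) (c 0 5) (c 1 2) + chainCross P (a 0) (c 0 5) (c 1 3) +
    chainCross P (a 0) (c 0 5) (c 1 4) + chainCross P (a 0) (c 0 5) (c 2 3) +
    chainCross P (a 0) (c 0 5) (c 2 4) + chainCross P (a 0) (c 0 5) (c 3 4)) *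
    (CharTwo.two_eq_zero : (2 : ZMod 2) = 0)

end Chains

section Geometry

theorem coneFrom_segment (p a b : Fin 3 → ℝ) :
    coneFrom p (segment ℝ a b) = convexHull ℝ {p, a, b} := by
  rw [convexHull_insert (by simp), convexHull_pair, coneFrom]
  ext
  simp [convexJoin]

theorem exists_weights_of_mem_coneFrom {p a b x : Fin 3 → ℝ}
    (h : x ∈ coneFrom p (segment ℝ a b)) :
    ∃ α β γ : ℝ, 0 ≤ α ∧ 0 ≤ β ∧ 0 ≤ γ ∧ α + β + γ = 1 ∧ α • p + β • a + γ • b = x := by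
  simp only [coneFrom, mem_iUnion, exists_prop] at h
  obtain ⟨y, ⟨s, t, hs, ht, hst, rfl⟩, u, w, hu, hw, huw, rfl⟩ := h
  refine ⟨u, w * s, w * t, hu, by positivity, by positivity,
    by linear_combination huw + w * hst, ?_⟩
  rw [smul_add, smul_smul, smul_smul, add_assoc]

theorem mem_coneFrom_of_weights {p a b : Fin 3 → ℝ} {α β γ : ℝ} (hα : 0 ≤ α) (hβ : 0 ≤ β)
    (hγ : 0 ≤ γ) (h : α + β + γ = 1) : α • p + β • a + γ • b ∈ coneFrom p (segment ℝ a b) := by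
  rw [coneFrom_segment]
  have hc := convex_convexHull ℝ ({p, a, b} : Set (Fin 3 → ℝ))
  have hp : p ∈ convexHull ℝ ({p, a, b} : Set (Fin 3 → ℝ)) := subset_convexHull _ _ (by simp)
  have ha : a ∈ convexHull ℝ ({p, a, b} : Set (Fin 3 → ℝ)) := subset_convexHull _ _ (by simp)
  have hb : b ∈ convexHull ℝ ({p, a, b} : Set (Fin 3 → ℝ)) := subset_convexHull _ _ (by simp)
  have := hc.sum_mem (t := Finset.univ) (w := ![α, β, γ]) (z := ![p, a, b])
    (by intro i; fin_cases i <;> simp [*]) (by simp [Fin.sum_univ_three, h])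
    (by intro i; fin_cases i <;> simp [*])
  simpa [Fin.sum_univ_three] using this

/-- The segment `c d` meets the triangle `p a b`. -/
def Meets (p a b c d : Fin 3 → ℝ) : Prop :=
  (coneFrom p (segment ℝ a b) ∩ segment ℝ c d).Nonempty

theorem orient_comb_first {α β γ : ℝ} (h : α + β + γ = 1) (p a b y c d : Fin 3 → ℝ) :
    orient (α • p + β • a + γ • b) y c d =
      α * orient p y c d + β * orient a y c d + γ * orient b y c d := by
  obtain rfl : α = 1 - β - γ := by linarith
  simp [orient]
  ring

theorem orient_comb_last {δ ε : ℝ} (h : δ + ε = 1) (p a b c d : Fin 3 → ℝ) :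
    orient p a b (δ • c + ε • d) = δ * orient p a b c + ε * orient p a b d := by
  obtain rfl : δ = 1 - ε := by linarith
  simp [orient]
  ring

theorem orient_line {δ ε : ℝ} (h : δ + ε = 1) (y c d : Fin 3 → ℝ) :
    orient (δ • c + ε • d) y c d = 0 := by
  obtain rfl : δ = 1 - ε := by linarith
  simp [orient]
  ring

theorem orient_plane {α β γ : ℝ} (h : α + β + γ = 1) (p a b : Fin 3 → ℝ) :
    orient p a b (α • p + β • a + γ • b) = 0 := by
  obtain rfl : α = 1 - β - γ := by linarith
  simp [orient]
  ring

theorem orient_eq_zero_of_mem_coneFrom {p a b x : Fin 3 → ℝ}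
    (h : x ∈ coneFrom p (segment ℝ a b)) : orient p a b x = 0 := by
  obtain ⟨α, β, γ, -, -, -, hs, rfl⟩ := exists_weights_of_mem_coneFrom h
  exact orient_plane hs p a b

theorem orient_swap_first (a b c d : Fin 3 → ℝ) : orient b a c d = -orient a b c d := by
  simp only [orient]
  ring

/-- The linear relations between the weights of a common point of a triangle and a segment. -/
theorem weights_relations {p a b c d : Fin 3 → ℝ} {α β γ δ ε : ℝ} (h : α + β + γ = 1)
    (h' : δ + ε = 1) (hx : α • p + β • a + γ • b = δ • c + ε • d) :
    β * orient p a c d = γ * orient b p c d ∧ α * orient p a c d = γ * orient a b c d ∧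
      α * orient b p c d = β * orient a b c d ∧
      δ * orient p a b c + ε * orient p a b d = 0 := by
  have e (y : Fin 3 → ℝ) : α * orient p y c d + β * orient a y c d + γ * orient b y c d = 0 := by
    rw [← orient_comb_first h, hx, orient_line h']
  have z (y : Fin 3 → ℝ) : orient y y c d = 0 := by
    simp only [orient]
    ring
  have e₁ := e p
  have e₂ := e a
  have e₃ := e b
  rw [z] at e₁ e₂ e₃
  rw [orient_swap_first p a] at e₁
  rw [orient_swap_first a b] at e₂
  rw [orient_swap_first b p] at e₃
  refine ⟨by linarith, by linarith, by linarith, ?_⟩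
  rw [← orient_comb_last h', ← hx, orient_plane h]

theorem triCross_eq_one_iff (p a b c d : Fin 3 → ℝ) :
    triCross p a b c d = 1 ↔ negOrient p a b c ≠ negOrient p a b d ∧
      negOrient p a c d = negOrient a b c d ∧ negOrient a b c d = negOrient b p c d := by
  rw [triCross, crossSign]
  generalize negOrient p a b c = x₁, negOrient p a b d = x₂, negOrient p a c d = x₃,
    negOrient a b c d = x₄, negOrient b p c d = x₅
  revert x₁ x₂ x₃ x₄ x₅
  decide

theorem triCross_eq_zero_of_ne_one {p a b c d : Fin 3 → ℝ} (h : triCross p a b c d ≠ 1) :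
    triCross p a b c d = 0 := by
  revert h
  generalize triCross p a b c d = t
  revert t
  decide

theorem meets_of_triCross {p a b c d : Fin 3 → ℝ} (h : triCross p a b c d = 1)
    (h₁ : orient p a c d ≠ 0) (h₂ : orient a b c d ≠ 0) (h₃ : orient b p c d ≠ 0) :
    Meets p a b c d := by
  rw [triCross_eq_one_iff] at h
  obtain ⟨h12, h34, h45⟩ := h
  simp only [negOrient, ne_eq, decide_eq_decide] at h12 h34 h45
  have hsum : orient a b c d + orient b p c d + orient p a c d =
      orient p a b d - orient p a b c := by
    simp only [orient]
    ring
  have hpt (i : Fin 3) : orient a b c d * p i + orient b p c d * a i + orient p a c d * b i =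
      orient p a b d * c i - orient p a b c * d i := by
    fin_cases i <;> simp only [orient, Fin.zero_eta, Fin.mk_one, Fin.reduceFinMk] <;> ring
  have key : ∀ S : ℝ, S ≠ 0 → S = orient p a b d - orient p a b c →
      0 ≤ orient a b c d / S → 0 ≤ orient b p c d / S → 0 ≤ orient p a c d / S →
      0 ≤ orient p a b d / S → 0 ≤ -orient p a b c / S → Meets p a b c d := by
    intro S hS hSe k₁ k₂ k₃ k₄ k₅
    refine ⟨_, mem_coneFrom_of_weights k₁ k₂ k₃ ?_, _, _, k₄, k₅, ?_, ?_⟩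
    · field_simp
      rw [hsum, hSe]
    · field_simp
      rw [hSe]
      ring
    · ext i
      simp only [Pi.add_apply, Pi.smul_apply, smul_eq_mul]
      field_simp
      linear_combination -hpt i
  rcases lt_or_gt_of_ne h₂ with h | h
  · have h5 := h45.1 h
    have h3 := h34.2 h
    have h1 : ¬ orient p a b d < 0 → False := fun h2 => by
      have : orient p a b c < 0 := by
        by_contra h1
        exact h12 ⟨fun h => absurd h h1, fun h => absurd h h2⟩
      linarith
    have h2 : 0 ≤ orient p a b c := by
      by_contra h2
      exact h12 ⟨fun _ => by_contra h1, fun _ => by linarith⟩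
    have h1' : orient p a b d < 0 := by_contra h1
    have hS : orient p a b d - orient p a b c < 0 := by linarith
    exact key _ hS.ne rfl (div_nonneg_of_nonpos h.le hS.le) (div_nonneg_of_nonpos h5.le hS.le)
      (div_nonneg_of_nonpos h3.le hS.le) (div_nonneg_of_nonpos h1'.le hS.le)
      (div_nonneg_of_nonpos (by linarith) hS.le)
  · have h5 : 0 < orient b p c d := lt_of_le_of_ne (not_lt.1 fun h' => by
      have := h45.2 h'
      linarith) h₃.symm
    have h3 : 0 < orient p a c d := lt_of_le_of_ne (not_lt.1 fun h' => by
      have := h34.1 h'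
      linarith) h₁.symm
    have h1 : 0 ≤ orient p a b d := by
      by_contra h2
      exact h12 ⟨fun _ => by linarith, fun _ => by linarith⟩
    have h2 : orient p a b c < 0 := by
      by_contra h2
      exact h12 ⟨fun h => absurd h h2, fun h => by linarith⟩
    have hS : 0 < orient p a b d - orient p a b c := by linarith
    exact key _ hS.ne' rfl (div_nonneg h.le hS.le) (div_nonneg h5.le hS.le)
      (div_nonneg h3.le hS.le) (div_nonneg h1 hS.le) (div_nonneg (by linarith) hS.le)

theorem triCross_of_meets {p a b c d : Fin 3 → ℝ} (h : Meets p a b c d)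
    (h₁ : orient p a b c ≠ 0) (h₂ : orient p a b d ≠ 0) (h₃ : orient p a c d ≠ 0)
    (h₄ : orient a b c d ≠ 0) (h₅ : orient b p c d ≠ 0) : triCross p a b c d = 1 := by
  obtain ⟨x, hx, δ, ε, hδ, hε, hde, hxe⟩ := h
  obtain ⟨α, β, γ, hα, hβ, hγ, hs, rfl⟩ := exists_weights_of_mem_coneFrom hx
  obtain ⟨r₁, r₂, r₃, r₄⟩ := weights_relations hs hde hxe.symm
  have sgn : ∀ {s t u w : ℝ}, 0 ≤ s → 0 ≤ t → (s ≠ 0 ∨ t ≠ 0) → u ≠ 0 → w ≠ 0 → s * u = t * w →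
      (u < 0 ↔ w < 0) := by
    intro s t u w hs ht hst hu hw h
    have hs' : s ≠ 0 := by
      rintro rfl
      simp_all
    have ht' : t ≠ 0 := by
      rintro rfl
      simp_all
    have hs0 := lt_of_le_of_ne hs hs'.symm
    have ht0 := lt_of_le_of_ne ht ht'.symm
    constructor <;> intro h'
    · exact (pos_iff_neg_of_mul_neg (h ▸ mul_neg_of_pos_of_neg hs0 h')).1 ht0
    · exact (pos_iff_neg_of_mul_neg (h.symm ▸ mul_neg_of_pos_of_neg ht0 h')).1 hs0
  have hne : ∀ {s t u w : ℝ}, u ≠ 0 → w ≠ 0 → s * u = t * w → s = 0 → t = 0 := by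
    intro s t u w hu hw h hs
    simp_all
  have hα' : α ≠ 0 := fun h0 => by
    have := hne h₃ h₄ r₂ h0
    have := hne h₅ h₄ r₃ h0
    linarith
  rw [triCross_eq_one_iff]
  simp only [negOrient, ne_eq, decide_eq_decide]
  refine ⟨?_, sgn hα hγ (Or.inl hα') h₃ h₄ r₂, (sgn hα hβ (Or.inl hα') h₅ h₄ r₃).symm⟩
  have := sgn hδ hε (by by_contra! h; linarith) h₁ (neg_ne_zero.2 h₂) (by linarith)
  rw [this]
  intro h
  rcases lt_or_gt_of_ne h₂ with h0 | h0
  · have := h.2 h0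
    linarith
  · have := h.1 (by linarith)
    linarith

end Geometry

section Perturbation

open Filter Topology

theorem eventually_residual_ne_zero {E : Type*} [NormedAddCommGroup E] [NormedSpace ℝ E]
    {g : E → ℝ} (hg : AnalyticOnNhd ℝ g univ) {w : E} (hw : g w ≠ 0) :
    ∀ᶠ x in residual E, g x ≠ 0 := by
  refine residual_of_dense_open
    (isOpen_ne_fun (continuousOn_univ.1 hg.continuousOn) continuous_const) ?_
  refine dense_iff_inter_open.2 fun U hU ⟨x, hx⟩ => ?_
  by_contra h
  have h0 : g =ᶠ[𝓝 x] 0 := by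
    filter_upwards [hU.mem_nhds hx] with y hy
    by_contra hy0
    exact h ⟨y, hy, hy0⟩
  exact hw (hg.eqOn_zero_of_preconnected_of_eventuallyEq_zero isPreconnected_univ
    (mem_univ x) h0 (mem_univ w))

theorem analyticOnNhd_orient {E : Type*} [NormedAddCommGroup E] [NormedSpace ℝ E]
    {a b c d : E → Fin 3 → ℝ} (ha : AnalyticOnNhd ℝ a univ) (hb : AnalyticOnNhd ℝ b univ)
    (hc : AnalyticOnNhd ℝ c univ) (hd : AnalyticOnNhd ℝ d univ) :
    AnalyticOnNhd ℝ (fun x => orient (a x) (b x) (c x) (d x)) univ := by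
  intro x hx
  have h : ∀ {a : E → Fin 3 → ℝ}, AnalyticOnNhd ℝ a univ → ∀ i, AnalyticAt ℝ (fun x => a x i) x :=
    fun ha i => ((ContinuousLinearMap.proj (R := ℝ) (φ := fun _ : Fin 3 => ℝ) i).analyticAt _).comp
      (ha x hx)
  have ha := h ha
  have hb := h hb
  have hc := h hc
  have hd := h hd
  unfold orient
  fun_prop

theorem continuous_orient {X : Type*} [TopologicalSpace X] {a b c d : X → Fin 3 → ℝ}
    (ha : Continuous a) (hb : Continuous b) (hc : Continuous c) (hd : Continuous d) :
    Continuous fun x => orient (a x) (b x) (c x) (d x) := by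
  unfold orient
  fun_prop

theorem exists_orient_ne_zero {ι : Type*} {i j k l : ι} (h : [i, j, k, l].Nodup) :
    ∃ P : ι → Fin 3 → ℝ, orient (P i) (P j) (P k) (P l) ≠ 0 := by
  classical
  refine ⟨fun m => if m = j then ![1, 0, 0] else if m = k then ![0, 1, 0] else
    if m = l then ![0, 0, 1] else 0, ?_⟩
  simp only [List.nodup_cons, List.mem_cons, List.not_mem_nil, not_or, or_false] at h
  obtain ⟨⟨h1, h2, h3⟩, ⟨h4, h5⟩, h6, -⟩ := h
  simp [orient, h1, h2, h3, Ne.symm h4, Ne.symm h5, Ne.symm h6]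

theorem dense_genPos (ι : Type*) [Fintype ι] : Dense {P : ι → Fin 3 → ℝ | GenPos P} := by
  apply dense_of_mem_residual
  refine eventually_all.2 fun i => eventually_all.2 fun j => eventually_all.2 fun k =>
    eventually_all.2 fun l => ?_
  by_cases h : [i, j, k, l].Nodup
  · obtain ⟨P, hP⟩ := exists_orient_ne_zero h
    have hp (m : ι) : AnalyticOnNhd ℝ (fun P : ι → Fin 3 → ℝ => P m) univ := fun x _ =>
      (ContinuousLinearMap.proj (R := ℝ) (φ := fun _ : ι => Fin 3 → ℝ) m).analyticAt _
    filter_upwards [eventually_residual_ne_zero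
      (analyticOnNhd_orient (hp i) (hp j) (hp k) (hp l)) hP] with P hP _
    exact hP
  · exact Eventually.of_forall fun P hP => absurd hP h

/-- The point `p` avoids the planes that matter for the intersection of the triangle `p a b`
with the segment `c d`. -/
structure GenericApex (p a b c d : Fin 3 → ℝ) : Prop where
  orient_ne_zero : orient a b c d ≠ 0 →
    orient p a b c ≠ 0 ∧ orient p a b d ≠ 0 ∧ orient p a c d ≠ 0 ∧ orient b p c d ≠ 0
  exists_plane : orient a b c d = 0 →
    ∃ n : (Fin 3 → ℝ) →ₗ[ℝ] ℝ, n b = n a ∧ n c = n a ∧ n d = n a ∧ n p ≠ n a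

theorem orient_ne_zero_of_meets {p a b c d : Fin 3 → ℝ} (hg : GenericApex p a b c d)
    (hd : Disjoint (segment ℝ a b) (segment ℝ c d)) (h : Meets p a b c d) :
    orient a b c d ≠ 0 := by
  intro h0
  obtain ⟨n, hb, hc, hd', hp⟩ := hg.exists_plane h0
  obtain ⟨x, hx, hx'⟩ := h
  obtain ⟨α, β, γ, hα, hβ, hγ, hs, hxe⟩ := exists_weights_of_mem_coneFrom hx
  have hx'' := hx'
  obtain ⟨δ, ε, hδ, hε, hde, hxe'⟩ := hx'
  have hn := congrArg n (hxe.trans hxe'.symm)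
  simp only [map_add, map_smul, smul_eq_mul, hb, hc, hd'] at hn
  have : α = 0 := by
    have : α * (n p - n a) = 0 := by linear_combination hn - n a * hs + n a * hde
    exact (mul_eq_zero.1 this).resolve_right (sub_ne_zero.2 hp)
  subst this
  refine disjoint_left.1 hd ⟨β, γ, hβ, hγ, by linarith, ?_⟩ hx''
  rw [← hxe, zero_smul, zero_add]

variable {ι : Type*}

theorem eventually_not_meets {P₀ : ι → Fin 3 → ℝ} {p a b c d : ι}
    (h : ¬ Meets (P₀ p) (P₀ a) (P₀ b) (P₀ c) (P₀ d)) :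
    ∀ᶠ P in 𝓝 P₀, ¬ Meets (P p) (P a) (P b) (P c) (P d) := by
  rw [Meets, not_nonempty_iff_eq_empty, ← disjoint_iff_inter_eq_empty, coneFrom_segment] at h
  obtain ⟨f, u, v, hu, huv, hv⟩ := geometric_hahn_banach_compact_closed (convex_convexHull ℝ _)
    ((toFinite {P₀ p, P₀ a, P₀ b}).isCompact_convexHull ℝ) (convex_segment _ _)
    (convexHull_pair (𝕜 := ℝ) (P₀ c) (P₀ d) ▸ (toFinite {P₀ c, P₀ d}).isClosed_convexHull ℝ) h
  have hl (m : ι) (hm : P₀ m ∈ ({P₀ p, P₀ a, P₀ b} : Set (Fin 3 → ℝ))) :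
      ∀ᶠ P : ι → Fin 3 → ℝ in 𝓝 P₀, f (P m) < u :=
    (f.continuous.comp (continuous_apply m)).continuousAt.eventually_lt continuousAt_const
      (hu _ (subset_convexHull _ _ hm))
  have hr (m : ι) (hm : P₀ m ∈ segment ℝ (P₀ c) (P₀ d)) :
      ∀ᶠ P : ι → Fin 3 → ℝ in 𝓝 P₀, v < f (P m) :=
    continuousAt_const.eventually_lt (f.continuous.comp (continuous_apply m)).continuousAt
      (hv _ hm)
  filter_upwards [hl p (by simp), hl a (by simp), hl b (by simp),
    hr c (left_mem_segment ℝ _ _), hr d (right_mem_segment ℝ _ _)] with P hp ha hb hc hd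
  rintro ⟨x, hx, hx'⟩
  rw [coneFrom_segment] at hx
  have h₁ : x ∈ {y | f y < u} := convexHull_min (by
    rintro y (rfl | rfl | rfl) <;> assumption) (convex_halfSpace_lt f.isLinear u) hx
  have h₂ : x ∈ {y | v < f y} := (convex_halfSpace_gt f.isLinear v).segment_subset hc hd hx'
  exact (lt_trans h₂ (lt_trans h₁ huv)).false

theorem eventually_negOrient_eq {P₀ : ι → Fin 3 → ℝ} {i j k l : ι}
    (h : orient (P₀ i) (P₀ j) (P₀ k) (P₀ l) ≠ 0) :
    ∀ᶠ P in 𝓝 P₀, negOrient (P i) (P j) (P k) (P l) =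
      negOrient (P₀ i) (P₀ j) (P₀ k) (P₀ l) := by
  have hc : ContinuousAt (fun P : ι → Fin 3 → ℝ => orient (P i) (P j) (P k) (P l)) P₀ :=
    (continuous_orient (continuous_apply i) (continuous_apply j) (continuous_apply k)
      (continuous_apply l)).continuousAt
  rcases lt_or_gt_of_ne h with h | h
  · filter_upwards [hc.eventually_lt continuousAt_const h] with P hP
    simp [negOrient, hP, h]
  · filter_upwards [continuousAt_const.eventually_lt hc h] with P hP
    simp [negOrient, hP.not_gt, h.not_gt]

open Classical in
/-- Under the genericity hypotheses, whether the triangle meets the segment can be read off any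
nearby configuration in general position. -/
theorem eventually_triCross_eq {P₀ : ι → Fin 3 → ℝ} {p a b c d : ι}
    (hg : GenericApex (P₀ p) (P₀ a) (P₀ b) (P₀ c) (P₀ d))
    (hd : Disjoint (segment ℝ (P₀ a) (P₀ b)) (segment ℝ (P₀ c) (P₀ d)))
    (hn : [p, a, b, c, d].Nodup) :
    ∀ᶠ P in 𝓝 P₀, GenPos P → triCross (P p) (P a) (P b) (P c) (P d) =
      if Meets (P₀ p) (P₀ a) (P₀ b) (P₀ c) (P₀ d) then 1 else 0 := by
  split_ifs with h
  · have h₄ := orient_ne_zero_of_meets hg hd h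
    obtain ⟨h₁, h₂, h₃, h₅⟩ := hg.orient_ne_zero h₄
    filter_upwards [eventually_negOrient_eq h₁, eventually_negOrient_eq h₂,
      eventually_negOrient_eq h₃, eventually_negOrient_eq h₄, eventually_negOrient_eq h₅]
      with P e₁ e₂ e₃ e₄ e₅ _
    rw [← triCross_of_meets h h₁ h₂ h₃ h₄ h₅, triCross, triCross, e₁, e₂, e₃, e₄, e₅]
  · filter_upwards [eventually_not_meets h] with P hP hgen
    refine triCross_eq_zero_of_ne_one fun h1 => hP (meets_of_triCross h1 ?_ ?_ ?_) <;>
    · apply hgen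
      simp only [List.nodup_cons, List.mem_cons, List.not_mem_nil, not_or, or_false] at hn ⊢
      tauto

end Perturbation

section GenericApex

open Filter Topology

theorem eventually_residual_orient_ne_zero {a b c d : Fin 3 → ℝ} (h : orient d a b c ≠ 0) :
    ∀ᶠ p in residual (Fin 3 → ℝ), orient p a b c ≠ 0 :=
  eventually_residual_ne_zero (g := fun p => orient p a b c)
    (analyticOnNhd_orient analyticOnNhd_id analyticOnNhd_const analyticOnNhd_const
      analyticOnNhd_const) h

theorem exists_plane_of_orient_eq_zero {a b c d : Fin 3 → ℝ} (h : orient a b c d = 0) :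
    ∃ n : (Fin 3 → ℝ) →ₗ[ℝ] ℝ, n ≠ 0 ∧ n b = n a ∧ n c = n a ∧ n d = n a := by
  have hdet : (Matrix.of ![b - a, c - a, d - a]).det = 0 := by
    rw [← h, Matrix.det_fin_three]
    simp [orient]
    ring
  obtain ⟨v, hv, hM⟩ := Matrix.exists_mulVec_eq_zero_iff.2 hdet
  refine ⟨dotProductBilin ℝ ℝ v, fun h0 => hv (dotProduct_eq_zero v fun w => ?_), ?_, ?_, ?_⟩
  · exact LinearMap.congr_fun h0 w
  · rw [← sub_eq_zero, ← map_sub]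
    exact (dotProduct_comm v (b - a)).trans (congrFun hM 0)
  · rw [← sub_eq_zero, ← map_sub]
    exact (dotProduct_comm v (c - a)).trans (congrFun hM 1)
  · rw [← sub_eq_zero, ← map_sub]
    exact (dotProduct_comm v (d - a)).trans (congrFun hM 2)

theorem eventually_genericApex (a b c d : Fin 3 → ℝ) :
    ∀ᶠ p in residual (Fin 3 → ℝ), GenericApex p a b c d := by
  by_cases h : orient a b c d = 0
  · obtain ⟨n, hn, hb, hc, hd⟩ := exists_plane_of_orient_eq_zero h
    obtain ⟨w, hw⟩ : ∃ w, n w ≠ 0 := by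
      by_contra! h0
      exact hn (LinearMap.ext h0)
    have hA : AnalyticOnNhd ℝ (fun p => n p - n a) univ := fun p _ =>
      (n.toContinuousLinearMap.analyticAt p).sub analyticAt_const
    filter_upwards [eventually_residual_ne_zero hA (w := a + w) (by simpa using hw)] with p hp
    exact ⟨fun h' => absurd h h', fun _ => ⟨n, hb, hc, hd, sub_ne_zero.1 hp⟩⟩
  · have h₁ : orient d a b c ≠ 0 := fun h' =>
      h (by rw [← neg_eq_zero, ← h']; simp only [orient]; ring)
    have h₂ : orient c a b d ≠ 0 := fun h' => h (by rw [← h']; simp only [orient]; ring)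
    have h₃ : orient b a c d ≠ 0 := fun h' =>
      h (by rw [← neg_eq_zero, ← h']; simp only [orient]; ring)
    filter_upwards [eventually_residual_orient_ne_zero h₁, eventually_residual_orient_ne_zero h₂,
      eventually_residual_orient_ne_zero h₃, eventually_residual_orient_ne_zero h]
      with p p₁ p₂ p₃ p₄
    refine ⟨fun _ => ⟨p₁, p₂, p₃, ?_⟩, fun h' => absurd h' h⟩
    rwa [orient_swap_first, neg_ne_zero]

/-- The point `p` is generic with respect to the planes through it and the segments `a b`,
`a' b'`: they do not meet the line `c d` at the same point, unless `a b` and `a' b'` are on the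
same line. -/
def GenericPair (p a b a' b' c d : Fin 3 → ℝ) : Prop :=
  orient a b c d ≠ 0 → orient a' b' c d ≠ 0 →
    (orient a a' b' c = 0 ∧ orient b a' b' c = 0 ∧ orient a a' b' d = 0 ∧ orient b a' b' d = 0) ∨
      orient p a b d * orient p a' b' c - orient p a b c * orient p a' b' d ≠ 0

theorem eventually_genericPair (a b a' b' c d : Fin 3 → ℝ) :
    ∀ᶠ p in residual (Fin 3 → ℝ), GenericPair p a b a' b' c d := by
  by_cases h : orient a b c d = 0
  · exact Eventually.of_forall fun p h' => absurd h h'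
  by_cases h0 : orient a a' b' c = 0 ∧ orient b a' b' c = 0 ∧ orient a a' b' d = 0 ∧
      orient b a' b' d = 0
  · exact Eventually.of_forall fun p _ _ => Or.inl h0
  have hA (x y z : Fin 3 → ℝ) : AnalyticOnNhd ℝ (fun p => orient p x y z) univ :=
    analyticOnNhd_orient analyticOnNhd_id analyticOnNhd_const analyticOnNhd_const
      analyticOnNhd_const
  suffices hw : ∃ w, orient w a b d * orient w a' b' c - orient w a b c * orient w a' b' d ≠ 0 by
    obtain ⟨w, hw⟩ := hw
    filter_upwards [eventually_residual_ne_zero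
      (((hA a b d).mul (hA a' b' c)).sub ((hA a b c).mul (hA a' b' d))) hw] with p hp _ _
    exact Or.inr hp
  by_contra! hw
  refine h0 ⟨?_, ?_, ?_, ?_⟩ <;> refine (mul_eq_zero.1 ?_).resolve_left h
  · have := hw ((1 / 2 : ℝ) • a + (1 / 2 : ℝ) • c)
    simp only [orient, Pi.add_apply, Pi.smul_apply, smul_eq_mul] at this ⊢
    linear_combination 4 * this
  · have := hw ((1 / 2 : ℝ) • b + (1 / 2 : ℝ) • c)
    simp only [orient, Pi.add_apply, Pi.smul_apply, smul_eq_mul] at this ⊢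
    linear_combination 4 * this
  · have := hw ((1 / 2 : ℝ) • a + (1 / 2 : ℝ) • d)
    simp only [orient, Pi.add_apply, Pi.smul_apply, smul_eq_mul] at this ⊢
    linear_combination 4 * this
  · have := hw ((1 / 2 : ℝ) • b + (1 / 2 : ℝ) • d)
    simp only [orient, Pi.add_apply, Pi.smul_apply, smul_eq_mul] at this ⊢
    linear_combination 4 * this

end GenericApex

section Counting

variable {p a b c d a' b' x : Fin 3 → ℝ}

theorem eq_of_mem_coneFrom_of_mem_segment {y : Fin 3 → ℝ} (h : orient p a b c ≠ 0)
    (hx : x ∈ coneFrom p (segment ℝ a b)) (hx' : x ∈ segment ℝ c d)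
    (hy : y ∈ coneFrom p (segment ℝ a b)) (hy' : y ∈ segment ℝ c d) : x = y := by
  obtain ⟨δ, ε, -, -, h₁, rfl⟩ := hx'
  obtain ⟨δ', ε', -, -, h₂, rfl⟩ := hy'
  have e₁ := orient_eq_zero_of_mem_coneFrom hx
  have e₂ := orient_eq_zero_of_mem_coneFrom hy
  rw [orient_comb_last h₁] at e₁
  rw [orient_comb_last h₂] at e₂
  obtain rfl : ε = 1 - δ := by linarith
  obtain rfl : ε' = 1 - δ' := by linarith
  have : δ = δ' := by
    have hne : orient p a b c - orient p a b d ≠ 0 := fun h0 => h (by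
      have h0 := sub_eq_zero.1 h0
      rw [← h0] at e₁
      linarith)
    refine sub_eq_zero.1 ((mul_eq_zero.1 ?_).resolve_right hne)
    linear_combination e₁ - e₂
  rw [this]

theorem not_mem_two_triangles (hg : GenericApex p a b c d) (hg' : GenericApex p a' b' c d)
    (hp : GenericPair p a b a' b' c d) (hd : Disjoint (segment ℝ a b) (segment ℝ c d))
    (hd' : Disjoint (segment ℝ a' b') (segment ℝ c d))
    (hi : segment ℝ a b ∩ segment ℝ a' b' ⊆ {a, b}) (hx : x ∈ coneFrom p (segment ℝ a b))
    (hx' : x ∈ coneFrom p (segment ℝ a' b')) (hc : x ∈ segment ℝ c d) : False := by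
  have h := orient_ne_zero_of_meets hg hd ⟨x, hx, hc⟩
  have h' := orient_ne_zero_of_meets hg' hd' ⟨x, hx', hc⟩
  obtain ⟨α, β, γ, hα, hβ, hγ, hs, hxe⟩ := exists_weights_of_mem_coneFrom hx
  obtain ⟨α', β', γ', hα', hβ', hγ', hs', hxe'⟩ := exists_weights_of_mem_coneFrom hx'
  have hc' := hc
  obtain ⟨δ, ε, hδ, hε, hde, hxc⟩ := hc
  have r := (weights_relations hs hde (hxe.trans hxc.symm)).2.2.2
  have r' := (weights_relations hs' hde (hxe'.trans hxc.symm)).2.2.2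
  rcases hp h h' with ⟨z₁, z₂, z₃, z₄⟩ | hQ
  · obtain ⟨p₁, -, p₃, p₅⟩ := hg.orient_ne_zero h
    obtain ⟨p₁', -⟩ := hg'.orient_ne_zero h'
    have key : α = α' := by
      have e := congrArg (fun z => orient z a' b' c) (hxe.trans hxe'.symm)
      simp only [orient_comb_first hs, orient_comb_first hs', z₁, z₂] at e
      have y₁ : orient a' a' b' c = 0 := by simp only [orient]; ring
      have y₂ : orient b' a' b' c = 0 := by simp only [orient]; ring
      rw [y₁, y₂] at e
      exact mul_right_cancel₀ p₁' (by linarith)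
    subst key
    have e : β • a + γ • b = β' • a' + γ' • b' := by
      have := hxe.trans hxe'.symm
      rw [add_assoc, add_assoc] at this
      exact add_left_cancel this
    have hα1 : α ≠ 1 := by
      rintro rfl
      obtain rfl : β = 0 := by linarith
      obtain rfl : γ = 0 := by linarith
      have hpx : p = x := by simpa using hxe
      apply p₃
      rw [hpx, ← hxc, orient_line hde]
    have hpos : 0 < 1 - α := lt_of_le_of_ne (by linarith) (sub_ne_zero.2 hα1.symm).symm
    have hy : (1 - α)⁻¹ • (β • a + γ • b) ∈ segment ℝ a b :=
      ⟨(1 - α)⁻¹ * β, (1 - α)⁻¹ * γ, by positivity, by positivity, by field_simp; linarith, by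
        rw [smul_add, smul_smul, smul_smul]⟩
    have hy' : (1 - α)⁻¹ • (β • a + γ • b) ∈ segment ℝ a' b' :=
      ⟨(1 - α)⁻¹ * β', (1 - α)⁻¹ * γ', by positivity, by positivity, by field_simp; linarith, by
        rw [e, smul_add, smul_smul, smul_smul]⟩
    have hxy : α • p + (1 - α) • ((1 - α)⁻¹ • (β • a + γ • b)) = x := by
      rw [smul_inv_smul₀ hpos.ne', ← hxe, add_assoc]
    have hα0 : ∀ y, (1 - α)⁻¹ • (β • a + γ • b) = y → orient p y c d ≠ 0 → False := by
      intro y hye hyne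
      rw [hye] at hxy
      have e := congrArg (fun z => orient z y c d) (hxy.trans hxc.symm)
      have e' := orient_comb_first (α := α) (β := 1 - α) (γ := 0) (by ring) p y y y c d
      have y₁ : orient y y c d = 0 := by simp only [orient]; ring
      rw [zero_smul, add_zero, y₁] at e'
      simp only [e', orient_line hde] at e
      have h0 : α = 0 := by simpa [hyne] using e
      subst h0
      rw [zero_smul, sub_zero, one_smul, zero_add, ← hye] at hxy
      rw [hxy] at hy
      exact disjoint_left.1 hd hy hc'
    rcases hi ⟨hy, hy'⟩ with h1 | h1
    · exact hα0 a h1 p₃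
    · refine hα0 b h1 ?_
      rwa [orient_swap_first, neg_ne_zero]
  · have h1 : δ * (orient p a b d * orient p a' b' c - orient p a b c * orient p a' b' d) = 0 := by
      linear_combination orient p a b d * r' - orient p a' b' d * r
    have h2 : ε * (orient p a b d * orient p a' b' c - orient p a b c * orient p a' b' d) = 0 := by
      linear_combination orient p a' b' c * r - orient p a b c * r'
    have := (mul_eq_zero.1 h1).resolve_right hQ
    have := (mul_eq_zero.1 h2).resolve_right hQ
    linarith

open Classical in
/-- For a generic apex `p`, the cone over a polygonal curve meets a disjoint polygonal curve in
a finite number of points, one for each pair of a triangle and an edge that meet. -/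
theorem finite_and_ncard_coneFrom_inter {κ κ' : Type*} {C : Finset κ} {C' : Finset κ'}
    {a b : κ → Fin 3 → ℝ} {c d : κ' → Fin 3 → ℝ}
    (hg : ∀ e ∈ C, ∀ f ∈ C', GenericApex p (a e) (b e) (c f) (d f))
    (hp : ∀ e ∈ C, ∀ e' ∈ C, ∀ f ∈ C', GenericPair p (a e) (b e) (a e') (b e') (c f) (d f))
    (hd : ∀ e ∈ C, ∀ f ∈ C', Disjoint (segment ℝ (a e) (b e)) (segment ℝ (c f) (d f)))
    (hC : ∀ e ∈ C, ∀ e' ∈ C, e ≠ e' →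
      segment ℝ (a e) (b e) ∩ segment ℝ (a e') (b e') ⊆ {a e, b e})
    (hC' : ∀ f ∈ C', ∀ f' ∈ C', f ≠ f' →
      segment ℝ (c f) (d f) ∩ segment ℝ (c f') (d f') ⊆ {c f, d f}) :
    (coneFrom p (⋃ e ∈ C, segment ℝ (a e) (b e)) ∩ ⋃ f ∈ C', segment ℝ (c f) (d f)).Finite ∧
    (((coneFrom p (⋃ e ∈ C, segment ℝ (a e) (b e)) ∩
      ⋃ f ∈ C', segment ℝ (c f) (d f)).ncard : ℕ) : ZMod 2) =
      ∑ e ∈ C, ∑ f ∈ C', if Meets p (a e) (b e) (c f) (d f) then 1 else 0 := by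
  have hpt (ef : κ × κ') : ∃ x, Meets p (a ef.1) (b ef.1) (c ef.2) (d ef.2) →
      x ∈ coneFrom p (segment ℝ (a ef.1) (b ef.1)) ∩ segment ℝ (c ef.2) (d ef.2) := by
    by_cases h : Meets p (a ef.1) (b ef.1) (c ef.2) (d ef.2)
    · exact ⟨h.choose, fun _ => h.choose_spec⟩
    · exact ⟨0, fun h' => absurd h' h⟩
  choose g hgx using hpt
  set M := (C ×ˢ C').filter fun ef => Meets p (a ef.1) (b ef.1) (c ef.2) (d ef.2) with hM
  have hne : ∀ e ∈ C, ∀ f ∈ C', Meets p (a e) (b e) (c f) (d f) →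
      orient p (a e) (b e) (c f) ≠ 0 ∧ orient p (a e) (b e) (d f) ≠ 0 := fun e he f hf h =>
    let h' := (hg e he f hf).orient_ne_zero
      (orient_ne_zero_of_meets (hg e he f hf) (hd e he f hf) h)
    ⟨h'.1, h'.2.1⟩
  have hS : coneFrom p (⋃ e ∈ C, segment ℝ (a e) (b e)) ∩ ⋃ f ∈ C', segment ℝ (c f) (d f) =
      g '' M := by
    ext x
    constructor
    · rintro ⟨hx, hx'⟩
      simp only [coneFrom, mem_iUnion, exists_prop] at hx hx'
      obtain ⟨y, ⟨e, he, hy⟩, hx⟩ := hx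
      obtain ⟨f, hf, hx'⟩ := hx'
      have hx : x ∈ coneFrom p (segment ℝ (a e) (b e)) := mem_biUnion hy hx
      have hm : Meets p (a e) (b e) (c f) (d f) := ⟨x, hx, hx'⟩
      have := hgx (e, f) hm
      exact ⟨(e, f), by simp [hM, he, hf, hm],
        eq_of_mem_coneFrom_of_mem_segment (hne e he f hf hm).1 this.1 this.2 hx hx'⟩
    · rintro ⟨⟨e, f⟩, hef, rfl⟩
      simp only [hM, Finset.coe_filter, Finset.mem_product, mem_ofPred_eq] at hef
      have := hgx (e, f) hef.2
      simp only [coneFrom, mem_iUnion, exists_prop, mem_inter_iff] at this ⊢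
      obtain ⟨⟨y, hy, hy'⟩, h2⟩ := this
      exact ⟨⟨y, ⟨e, hef.1.1, hy⟩, hy'⟩, f, hef.1.2, h2⟩
  have hinj : InjOn g M := by
    rintro ⟨e, f⟩ h1 ⟨e', f'⟩ h2 h
    simp only [hM, Finset.coe_filter, Finset.mem_product, mem_ofPred_eq] at h1 h2
    have m1 := hgx (e, f) h1.2
    have m2 := hgx (e', f') h2.2
    rw [← h] at m2
    obtain ⟨⟨he, hf⟩, h1⟩ := h1
    obtain ⟨⟨he', hf'⟩, h2⟩ := h2
    obtain rfl : f = f' := by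
      by_contra hff
      have := hne e he f hf h1
      rcases hC' f hf f' hf' hff ⟨m1.2, m2.2⟩ with h3 | h3
      · exact this.1 (orient_eq_zero_of_mem_coneFrom (h3 ▸ m1.1))
      · exact this.2 (orient_eq_zero_of_mem_coneFrom (h3 ▸ m1.1))
    by_contra hee
    have hee : e ≠ e' := fun h => hee (by rw [h])
    exact not_mem_two_triangles (hg e he f hf) (hg e' he' f hf) (hp e he e' he' f hf)
      (hd e he f hf) (hd e' he' f hf) (hC e he e' he' hee) m1.1 m2.1 m1.2
  rw [hS]
  refine ⟨M.finite_toSet.image g, ?_⟩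
  rw [hinj.ncard_image, ncard_coe_finset, hM, Finset.card_filter, Nat.cast_sum,
    Finset.sum_product]
  simp

end Counting

section Subdivision

open Filter Topology

/-- Indices for three apices, the vertices of `K₆`, and the points subdividing its edges. -/
abbrev SubdivIndex (m : ℕ) : Type := Fin 3 ⊕ Fin 6 ⊕ (Fin 6 × Fin 6 × Fin (m + 1))

variable {m : ℕ}

/-- The `k`-th vertex of the path subdividing the edge `i j`. -/
def pathVertex (i j : Fin 6) (k : Fin (m + 1)) : SubdivIndex m :=
  if k = 0 then .inr (.inl i) else if k = Fin.last m then .inr (.inl j) else .inr (.inr (i, j, k))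

/-- The path subdividing the edge `i j` in `m` edges. -/
def pathChain (m : ℕ) (i j : Fin 6) : Multiset (SubdivIndex m × SubdivIndex m) :=
  (Finset.univ : Finset (Fin m)).val.map fun k => (pathVertex i j k.castSucc, pathVertex i j k.succ)

/-- The vertices of the smallest face of `K₆` containing a point of its subdivision. -/
def faceLabel : SubdivIndex m → Finset (Fin 6) :=
  Sum.elim (fun _ => ∅) (Sum.elim (fun i => {i}) fun x => {x.1, x.2.1})

theorem faceLabel_pathVertex (i j : Fin 6) (k : Fin (m + 1)) :
    (faceLabel (pathVertex i j k)).Nonempty ∧ faceLabel (pathVertex i j k) ⊆ {i, j} := by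
  unfold pathVertex
  split_ifs <;> simp [faceLabel]

theorem pathVertex_injective (hm : m ≠ 0) {i j : Fin 6} (hij : i ≠ j) :
    Function.Injective (pathVertex (m := m) i j) := by
  intro k l h
  unfold pathVertex at h
  split_ifs at h <;> simp_all

theorem isArc_pathChain (hm : m ≠ 0) {i j : Fin 6} (hij : i ≠ j) :
    IsArc faceLabel (fun i => .inr (.inl i)) i j (pathChain m i j) where
  hasEnds φ := by
    have h₁ := Fin.sum_univ_castSucc fun k : Fin (m + 1) => φ (pathVertex i j k)
    have h₂ := Fin.sum_univ_succ fun k : Fin (m + 1) => φ (pathVertex i j k)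
    have e₀ : pathVertex (m := m) i j 0 = .inr (.inl i) := by simp [pathVertex]
    have e₁ : pathVertex (m := m) i j (Fin.last m) = .inr (.inl j) := by simp [pathVertex, hm]
    rw [e₁] at h₁
    rw [e₀] at h₂
    rw [pathChain, Multiset.map_map]
    change ∑ k : Fin m, (φ (pathVertex i j k.castSucc) + φ (pathVertex i j k.succ)) = _
    rw [Finset.sum_add_distrib]
    linear_combination h₂ - h₁ + (∑ k : Fin m, φ (pathVertex i j k.succ) - φ (.inr (.inl j))) *
      (CharTwo.two_eq_zero : (2 : ZMod 2) = 0)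
  ne e he := by
    simp only [pathChain, Multiset.mem_map] at he
    obtain ⟨k, -, rfl⟩ := he
    exact (pathVertex_injective hm hij).ne (Fin.castSucc_lt_succ).ne
  left e he := by
    simp only [pathChain, Multiset.mem_map] at he
    obtain ⟨k, -, rfl⟩ := he
    exact faceLabel_pathVertex i j k.castSucc
  right e he := by
    simp only [pathChain, Multiset.mem_map] at he
    obtain ⟨k, -, rfl⟩ := he
    exact faceLabel_pathVertex i j k.succ

/-- The edges of a triangle. -/
def triEdge (u v w : Fin 6) : Fin 3 → Fin 6 × Fin 6 := ![(u, v), (v, w), (u, w)]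

theorem sum_triChain_pathChain (g : SubdivIndex m × SubdivIndex m → ZMod 2) (u v w : Fin 6) :
    ((triChain (pathChain m) u v w).map g).sum = ∑ e : Fin 3 × Fin m,
      g (pathVertex (triEdge u v w e.1).1 (triEdge u v w e.1).2 e.2.castSucc,
        pathVertex (triEdge u v w e.1).1 (triEdge u v w e.1).2 e.2.succ) := by
  rw [Fintype.sum_prod_type, Fin.sum_univ_three]
  simp only [triChain, Multiset.map_add, Multiset.sum_add, pathChain, Multiset.map_map]
  rfl

theorem triEdge_lt {u v w : Fin 6} (huv : u < v) (hvw : v < w) (n : Fin 3) :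
    (triEdge u v w n).1 < (triEdge u v w n).2 := by
  fin_cases n
  exacts [huv, hvw, huv.trans hvw]

theorem triEdge_nodup {u v w x y z : Fin 6} (h : [u, v, w, x, y, z].Nodup) (n n' : Fin 3) :
    [(triEdge u v w n).1, (triEdge u v w n).2, (triEdge x y z n').1,
      (triEdge x y z n').2].Nodup := by
  simp only [List.nodup_cons, List.mem_cons, List.not_mem_nil, not_or, or_false] at h ⊢
  fin_cases n <;> fin_cases n' <;> simp [triEdge] <;> tauto

/-- The positions of the points of the subdivision, together with those of the apices. -/
def subdivPoint (A : Fin 6 → Fin 6 → Fin (m + 1) → Fin 3 → ℝ) (w : Fin 6 → Fin 3 → ℝ)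
    (q : Fin 3 → Fin 3 → ℝ) : SubdivIndex m → Fin 3 → ℝ :=
  Sum.elim q (Sum.elim w fun x => A x.1 x.2.1 x.2.2)

open Classical in
/-- The number modulo 2 of pairs of an edge of each of two subdivided triangles such that the
cone over the first edge meets the second. -/
def meetCount (A : Fin 6 → Fin 6 → Fin (m + 1) → Fin 3 → ℝ) (p : Fin 3 → ℝ)
    (u v w x y z : Fin 6) : ZMod 2 :=
  ∑ e : Fin 3 × Fin m, ∑ f : Fin 3 × Fin m,
    if Meets p (A (triEdge u v w e.1).1 (triEdge u v w e.1).2 e.2.castSucc)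
      (A (triEdge u v w e.1).1 (triEdge u v w e.1).2 e.2.succ)
      (A (triEdge x y z f.1).1 (triEdge x y z f.1).2 f.2.castSucc)
      (A (triEdge x y z f.1).1 (triEdge x y z f.1).2 f.2.succ) then 1 else 0

/-- The point `p` is generic with respect to a subdivided drawing of `K₆`. -/
def IsGenericFor (A : Fin 6 → Fin 6 → Fin (m + 1) → Fin 3 → ℝ) (p : Fin 3 → ℝ) : Prop :=
  ∀ (i j : Fin 6) (k : Fin m) (x y : Fin 6) (l : Fin m),
    GenericApex p (A i j k.castSucc) (A i j k.succ) (A x y l.castSucc) (A x y l.succ) ∧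
    ∀ (i' j' : Fin 6) (k' : Fin m), GenericPair p (A i j k.castSucc) (A i j k.succ)
      (A i' j' k'.castSucc) (A i' j' k'.succ) (A x y l.castSucc) (A x y l.succ)

theorem dense_isGenericFor (A : Fin 6 → Fin 6 → Fin (m + 1) → Fin 3 → ℝ) :
    Dense {p | IsGenericFor A p} := by
  apply dense_of_mem_residual
  refine eventually_all.2 fun i => eventually_all.2 fun j => eventually_all.2 fun k =>
    eventually_all.2 fun x => eventually_all.2 fun y => eventually_all.2 fun l =>
    (eventually_genericApex _ _ _ _).and <| eventually_all.2 fun i' => eventually_all.2 fun j' =>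
    eventually_all.2 fun k' => eventually_genericPair _ _ _ _ _ _

variable {A : Fin 6 → Fin 6 → Fin (m + 1) → Fin 3 → ℝ} {w : Fin 6 → Fin 3 → ℝ}

theorem subdivPoint_pathVertex (q : Fin 3 → Fin 3 → ℝ) (h₀ : ∀ i j, A i j 0 = w i)
    (h₁ : ∀ i j, A i j (Fin.last m) = w j) (i j : Fin 6) (k : Fin (m + 1)) :
    subdivPoint A w q (pathVertex i j k) = A i j k := by
  unfold pathVertex
  split_ifs with hk hk <;> simp_all [subdivPoint]

theorem nodup_apex_pathVertex (hm : m ≠ 0) (n : Fin 3) {i j x y : Fin 6}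
    (h : [i, j, x, y].Nodup) (k l : Fin m) :
    [(.inl n : SubdivIndex m), pathVertex i j k.castSucc, pathVertex i j k.succ,
      pathVertex x y l.castSucc, pathVertex x y l.succ].Nodup := by
  have e₁ (i j : Fin 6) (k : Fin (m + 1)) : (.inl n : SubdivIndex m) ≠ pathVertex i j k := by
    unfold pathVertex
    split_ifs <;> simp
  simp only [List.nodup_cons, List.mem_cons, List.not_mem_nil, not_or, or_false] at h
  have e₂ (k l : Fin (m + 1)) : pathVertex i j k ≠ pathVertex x y l := by
    intro h'
    obtain ⟨⟨t, ht⟩, h1⟩ := faceLabel_pathVertex i j k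
    have h2 := (faceLabel_pathVertex x y l).2
    rw [← h'] at h2
    have := h1 ht
    have := h2 ht
    simp only [Finset.mem_insert, Finset.mem_singleton] at *
    aesop
  have e₃ {i j : Fin 6} (hij : i ≠ j) (k : Fin m) := (pathVertex_injective hm hij).ne
    (Fin.castSucc_lt_succ (i := k)).ne
  simp only [List.nodup_cons, List.mem_cons, List.not_mem_nil, not_or, or_false]
  exact ⟨⟨e₁ _ _ _, e₁ _ _ _, e₁ _ _ _, e₁ _ _ _⟩, ⟨e₃ h.1.1 _, e₂ _ _, e₂ _ _⟩,
    ⟨e₂ _ _, e₂ _ _⟩, e₃ h.2.2.1 _, not_false, List.nodup_nil⟩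

/-- For generic apices, the numbers of intersections are those of a configuration in general
position. -/
theorem exists_genPos_chainCross_eq (hm : m ≠ 0) (h₀ : ∀ i j, A i j 0 = w i)
    (h₁ : ∀ i j, A i j (Fin.last m) = w j)
    (hd : ∀ i j x y, [i, j, x, y].Nodup → ∀ k l : Fin m,
      Disjoint (segment ℝ (A i j k.castSucc) (A i j k.succ))
        (segment ℝ (A x y l.castSucc) (A x y l.succ)))
    {p q : Fin 3 → ℝ} (hp : IsGenericFor A p) (hq : IsGenericFor A q) :
    ∃ P : SubdivIndex m → Fin 3 → ℝ, GenPos P ∧ ∀ u v w x y z, [u, v, w, x, y, z].Nodup →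
      chainCross P (.inl 0) (triChain (pathChain m) u v w) (triChain (pathChain m) x y z) =
        meetCount A p u v w x y z ∧
      chainCross P (.inl 1) (triChain (pathChain m) u v w) (triChain (pathChain m) x y z) =
        meetCount A q u v w x y z := by
  classical
  set P₀ := subdivPoint A w ![p, q, 0] with hP₀
  have hev : ∀ r, IsGenericFor A r → ∀ n : Fin 3, P₀ (.inl n) = r → ∀ᶠ P in 𝓝 P₀,
      ∀ i j x y, ∀ k l : Fin m, [i, j, x, y].Nodup → GenPos P → triCross (P (.inl n))
        (P (pathVertex i j k.castSucc)) (P (pathVertex i j k.succ))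
        (P (pathVertex x y l.castSucc)) (P (pathVertex x y l.succ)) =
        if Meets r (A i j k.castSucc) (A i j k.succ) (A x y l.castSucc) (A x y l.succ)
        then 1 else 0 := by
    intro r hr n hn
    refine eventually_all.2 fun i => eventually_all.2 fun j => eventually_all.2 fun x =>
      eventually_all.2 fun y => eventually_all.2 fun k => eventually_all.2 fun l => ?_
    by_cases hN : [i, j, x, y].Nodup
    · have e (i j : Fin 6) (k : Fin (m + 1)) : P₀ (pathVertex i j k) = A i j k :=
        subdivPoint_pathVertex _ h₀ h₁ i j k
      have := eventually_triCross_eq (P₀ := P₀) (p := .inl n) (a := pathVertex i j k.castSucc)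
        (b := pathVertex i j k.succ) (c := pathVertex x y l.castSucc) (d := pathVertex x y l.succ)
      simp only [e, hn] at this
      filter_upwards [this (hr i j k x y l).1 (hd i j x y hN k l)
        (nodup_apex_pathVertex hm n hN k l)] with P hP _
      exact hP
    · exact Eventually.of_forall fun P h => absurd h hN
  obtain ⟨P, hgen, hPp, hPq⟩ := ((mem_closure_iff_frequently.1 (dense_genPos _ P₀)).and_eventually
    ((hev p hp 0 rfl).and (hev q hq 1 rfl))).exists
  refine ⟨P, hgen, fun u v w x y z hN => ?_⟩
  simp only [chainCross, sum_triChain_pathChain, meetCount]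
  exact ⟨Finset.sum_congr rfl fun e _ => Finset.sum_congr rfl fun f _ =>
      hPp _ _ _ _ _ _ (triEdge_nodup hN _ _) hgen,
    Finset.sum_congr rfl fun e _ => Finset.sum_congr rfl fun f _ =>
      hPq _ _ _ _ _ _ (triEdge_nodup hN _ _) hgen⟩

theorem exists_meetCount_eq_one (hm : m ≠ 0) (h₀ : ∀ i j, A i j 0 = w i)
    (h₁ : ∀ i j, A i j (Fin.last m) = w j)
    (hd : ∀ i j x y, [i, j, x, y].Nodup → ∀ k l : Fin m,
      Disjoint (segment ℝ (A i j k.castSucc) (A i j k.succ))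
        (segment ℝ (A x y l.castSucc) (A x y l.succ))) :
    ∃ u v w x y z, u < v ∧ v < w ∧ x < y ∧ y < z ∧ [u, v, w, x, y, z].Nodup ∧
      ∀ p, IsGenericFor A p → meetCount A p u v w x y z = 1 := by
  have hc (i j : Fin 6) (hij : i < j) := isArc_pathChain hm hij.ne
  have ha : Function.Injective (Sum.inl : Fin 3 → SubdivIndex m) := Sum.inl_injective
  obtain ⟨p, hp⟩ := (dense_isGenericFor A).nonempty
  obtain ⟨u, v, w', x, y, z, huv, hvw, hxy, hyz, hN, h⟩ : ∃ u v w x y z, u < v ∧ v < w ∧ x < y ∧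
      y < z ∧ [u, v, w, x, y, z].Nodup ∧ meetCount A p u v w x y z = 1 := by
    obtain ⟨P, hP, hPe⟩ := exists_genPos_chainCross_eq hm h₀ h₁ hd hp hp
    have hsum := sum_chainCross_triChain hP ha (fun _ => rfl) (fun _ => rfl) hc
    by_contra! hne
    have hz : ∀ t : ZMod 2, t ≠ 1 → t = 0 := by decide
    have hne' : ∀ u v w x y z, u < v → v < w → x < y → y < z → [u, v, w, x, y, z].Nodup →
        chainCross P (.inl 0) (triChain (pathChain m) u v w) (triChain (pathChain m) x y z) = 0 :=
      fun u v w x y z h1 h2 h3 h4 hN => by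
        rw [(hPe u v w x y z hN).1]
        exact hz _ (hne u v w x y z h1 h2 h3 h4 hN)
    rw [hne' 0 1 2 3 4 5, hne' 0 1 3 2 4 5, hne' 0 1 4 2 3 5, hne' 0 1 5 2 3 4,
      hne' 0 2 3 1 4 5, hne' 0 2 4 1 3 5, hne' 0 2 5 1 3 4, hne' 0 3 4 1 2 5, hne' 0 3 5 1 2 4,
      hne' 0 4 5 1 2 3] at hsum
    · simp at hsum
    all_goals decide
  refine ⟨u, v, w', x, y, z, huv, hvw, hxy, hyz, hN, fun q hq => ?_⟩
  obtain ⟨P, hP, hPe⟩ := exists_genPos_chainCross_eq hm h₀ h₁ hd hp hq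
  rw [← (hPe u v w' x y z hN).2, ← h, ← (hPe u v w' x y z hN).1]
  exact (chainCross_triChain_apex hP ha (fun _ => rfl) hc huv hvw hxy hyz hN).symm

end Subdivision

section PiecewiseLinear

open AffineMap

theorem exists_subdivision (B : Finset ℝ) : ∃ m : ℕ, m ≠ 0 ∧ ∃ t : Fin (m + 1) → ℝ,
    StrictMono t ∧ t 0 = 0 ∧ t (Fin.last m) = 1 ∧
      ∀ b ∈ B, ∀ k : Fin m, b ∉ Ioo (t k.castSucc) (t k.succ) := by
  classical
  set S : Finset ℝ := insert 0 (insert 1 (B.filter (· ∈ Icc (0 : ℝ) 1))) with hS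
  have h0 : (0 : ℝ) ∈ S := by simp [hS]
  have h1 : (1 : ℝ) ∈ S := by simp [hS]
  have hI : ∀ x ∈ S, x ∈ Icc (0 : ℝ) 1 := by
    intro x hx
    simp only [hS, Finset.mem_insert, Finset.mem_filter] at hx
    rcases hx with rfl | rfl | hx
    exacts [by simp, by simp, hx.2]
  obtain ⟨m, hm⟩ : ∃ m, S.card = m + 1 := ⟨S.card - 1, by
    have := Finset.card_pos.2 ⟨0, h0⟩
    omega⟩
  set t := S.orderEmbOfFin hm with ht
  have hr : range t = S := Finset.range_orderEmbOfFin S hm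
  have htI (k) : t k ∈ Icc (0 : ℝ) 1 := hI _ (Finset.orderEmbOfFin_mem S hm k)
  have ht0 : t 0 = 0 := by
    obtain ⟨k, hk⟩ : (0 : ℝ) ∈ range t := hr ▸ h0
    exact le_antisymm (hk ▸ t.monotone (Fin.zero_le k)) (htI 0).1
  have ht1 : t (Fin.last m) = 1 := by
    obtain ⟨k, hk⟩ : (1 : ℝ) ∈ range t := hr ▸ h1
    exact le_antisymm (htI _).2 (hk ▸ t.monotone (Fin.le_last k))
  refine ⟨m, ?_, t, t.strictMono, ht0, ht1, fun b hb k hbk => ?_⟩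
  · rintro rfl
    exact zero_ne_one (ht0.symm.trans ht1)
  · have hbS : b ∈ S := by
      simp only [hS, Finset.mem_insert, Finset.mem_filter]
      exact Or.inr (Or.inr ⟨hb, (htI _).1.trans hbk.1.le, hbk.2.le.trans (htI _).2⟩)
    obtain ⟨l, rfl⟩ : b ∈ range t := hr ▸ hbS
    have h2 := t.lt_iff_lt.1 hbk.1
    have h3 := t.lt_iff_lt.1 hbk.2
    simp only [Fin.lt_def, Fin.val_castSucc, Fin.val_succ] at h2 h3
    omega

theorem lineMap_mem_graphRealization {i j : Fin 6} (hij : i ≠ j) {s : ℝ} (hs : s ∈ Icc (0 : ℝ) 1) :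
    lineMap (vert i) (vert j) s ∈ graphRealization (⊤ : SimpleGraph (Fin 6)) := by
  refine mem_iUnion.2 ⟨⟨(i, j), by simpa using hij⟩, ?_⟩
  rw [segment_eq_image_lineMap]
  exact mem_image_of_mem _ hs

/-- A piecewise linear map on the realization of `K₆` is affine on each edge of a suitable
subdivision. -/
theorem exists_affine_subdivision {f : (Fin 6 → ℝ) → (Fin 3 → ℝ)}
    (hPL : IsPLOn f (graphRealization (⊤ : SimpleGraph (Fin 6)))) :
    ∃ m : ℕ, m ≠ 0 ∧ ∃ t : Fin (m + 1) → ℝ, StrictMono t ∧ t 0 = 0 ∧ t (Fin.last m) = 1 ∧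
      ∀ i j : Fin 6, i ≠ j → ∀ k : Fin m, ∃ g : ℝ →ᵃ[ℝ] (Fin 3 → ℝ),
        EqOn (fun s => f (lineMap (vert i) (vert j) s)) g (Icc (t k.castSucc) (t k.succ)) := by
  classical
  obtain ⟨T, hT, hTc, hcov, hg⟩ := hPL
  set K : Set (Fin 6 → ℝ) × Fin 6 × Fin 6 → Set ℝ := fun x =>
    Icc 0 1 ∩ lineMap (k := ℝ) (vert x.2.1) (vert x.2.2) ⁻¹' x.1 with hK
  have hKI : ∀ P ∈ T, ∀ i j, (K (P, i, j)).Nonempty →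
      K (P, i, j) = Icc (sInf (K (P, i, j))) (sSup (K (P, i, j))) := by
    intro P hP i j hne
    obtain ⟨Q, hQ, rfl⟩ := hTc P hP
    have hconv : Convex ℝ (K (convexHull ℝ Q, i, j)) :=
      (convex_Icc _ _).inter ((convex_convexHull ℝ Q).affine_preimage _)
    have hcont : Continuous (lineMap (k := ℝ) (vert i) (vert j)) := lineMap_continuous
    have hcomp : IsCompact (K (convexHull ℝ Q, i, j)) :=
      isCompact_Icc.inter_right ((hQ.isClosed_convexHull ℝ).preimage hcont)
    exact eq_Icc_of_connected_compact ⟨hne, hconv.isPreconnected⟩ hcomp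
  obtain ⟨m, hm, t, htm, ht0, ht1, htB⟩ := exists_subdivision
    ((hT.toFinset ×ˢ Finset.univ).image (fun x => sInf (K x)) ∪
      (hT.toFinset ×ˢ Finset.univ).image fun x => sSup (K x))
  refine ⟨m, hm, t, htm, ht0, ht1, fun i j hij k => ?_⟩
  have hlt : t k.castSucc < t k.succ := htm Fin.castSucc_lt_succ
  have h0 : 0 ≤ t k.castSucc := ht0 ▸ htm.monotone (Fin.zero_le _)
  have h1 : t k.succ ≤ 1 := ht1 ▸ htm.monotone (Fin.le_last _)
  have hmid : (t k.castSucc + t k.succ) / 2 ∈ Icc (0 : ℝ) 1 := ⟨by linarith, by linarith⟩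
  obtain ⟨P, hP, hxP⟩ := hcov (lineMap_mem_graphRealization hij hmid)
  have hmK : (t k.castSucc + t k.succ) / 2 ∈ K (P, i, j) := ⟨hmid, hxP⟩
  have hKe := hKI P hP i j ⟨_, hmK⟩
  have hinf := htB (sInf (K (P, i, j)))
    (by simpa using Or.inl ⟨P, hP, i, j, rfl⟩) k
  have hsup := htB (sSup (K (P, i, j)))
    (by simpa using Or.inr ⟨P, hP, i, j, rfl⟩) k
  have hsub : Icc (t k.castSucc) (t k.succ) ⊆ K (P, i, j) := by
    rw [hKe] at hmK
    rw [hKe]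
    refine Icc_subset_Icc ?_ ?_
    · by_contra! h
      exact hinf ⟨h, by linarith [hmK.1]⟩
    · by_contra! h
      exact hsup ⟨by linarith [hmK.2], h⟩
  obtain ⟨g, hg⟩ := hg P hP
  exact ⟨g.comp (lineMap (vert i) (vert j)), fun s hs =>
    hg ⟨(hsub hs).2, lineMap_mem_graphRealization hij (hsub hs).1⟩⟩

theorem lineMap_vert_apply (i j l : Fin 6) (s : ℝ) :
    lineMap (vert i) (vert j) s l =
      (1 - s) * (if l = i then 1 else 0) + s * if l = j then 1 else 0 := by
  simp [lineMap_apply_module, vert]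

theorem lineMap_vert_injective {i j : Fin 6} (hij : i ≠ j) {s s' : ℝ}
    (h : lineMap (vert i) (vert j) s = lineMap (vert i) (vert j) s') : s = s' := by
  have := congrFun h j
  simpa [lineMap_vert_apply, hij.symm] using this

theorem eq_zero_or_one_of_lineMap_vert {i j x y : Fin 6} (hij : i ≠ j)
    (h : (i ≠ x ∧ i ≠ y) ∨ (j ≠ x ∧ j ≠ y)) {s s' : ℝ}
    (hs : lineMap (vert i) (vert j) s = lineMap (vert x) (vert y) s') : s = 0 ∨ s = 1 := by
  rcases h with h | h
  · have := congrFun hs i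
    simp [lineMap_vert_apply, hij, h.1, h.2] at this
    exact Or.inr (by linarith)
  · have := congrFun hs j
    simp [lineMap_vert_apply, hij.symm, h.1, h.2] at this
    exact Or.inl this

theorem lineMap_vert_ne {i j x y : Fin 6} (h : [i, j, x, y].Nodup) {s s' : ℝ} :
    lineMap (vert i) (vert j) s ≠ (lineMap (vert x) (vert y) s' : Fin 6 → ℝ) := by
  intro hs
  simp only [List.nodup_cons, List.mem_cons, List.not_mem_nil, not_or, or_false] at h
  have h1 := congrFun hs x
  have h2 := congrFun hs y
  simp [lineMap_vert_apply, h.2.2.1, Ne.symm h.2.2.1, Ne.symm h.1.2.1, Ne.symm h.1.2.2,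
    Ne.symm h.2.1.1, Ne.symm h.2.1.2] at h1 h2
  linarith

theorem mem_endpoints_of_mem_Icc {m : ℕ} {t : Fin (m + 1) → ℝ} (ht : StrictMono t) {k : Fin m}
    {l : Fin (m + 1)} (h : t l ∈ Icc (t k.castSucc) (t k.succ)) : l = k.castSucc ∨ l = k.succ := by
  have h1 := ht.le_iff_le.1 h.1
  have h2 := ht.le_iff_le.1 h.2
  simp only [Fin.le_def, Fin.ext_iff, Fin.val_castSucc, Fin.val_succ] at *
  omega

theorem mem_Icc_inter_Icc {m : ℕ} {t : Fin (m + 1) → ℝ} (ht : StrictMono t) {k k' : Fin m}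
    (hk : k ≠ k') {s : ℝ} (h : s ∈ Icc (t k.castSucc) (t k.succ))
    (h' : s ∈ Icc (t k'.castSucc) (t k'.succ)) : s = t k.castSucc ∨ s = t k.succ := by
  rcases lt_or_gt_of_ne hk with hlt | hlt
  · have : t k.succ ≤ t k'.castSucc := ht.monotone (by
      simp only [Fin.le_def, Fin.lt_def, Fin.val_castSucc, Fin.val_succ] at *; omega)
    exact Or.inr (le_antisymm h.2 (this.trans h'.1))
  · have : t k'.succ ≤ t k.castSucc := ht.monotone (by
      simp only [Fin.le_def, Fin.lt_def, Fin.val_castSucc, Fin.val_succ] at *; omega)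
    exact Or.inl (le_antisymm (h'.2.trans this) h.1)

theorem iUnion_Icc_eq {m : ℕ} {t : Fin (m + 1) → ℝ} (ht : StrictMono t) (h0 : t 0 = 0)
    (h1 : t (Fin.last m) = 1) : ⋃ k : Fin m, Icc (t k.castSucc) (t k.succ) = Icc 0 1 := by
  refine Subset.antisymm (iUnion_subset fun k => Icc_subset_Icc
    (h0 ▸ ht.monotone (Fin.zero_le _)) (h1 ▸ ht.monotone (Fin.le_last _))) fun s hs => ?_
  have key : ∀ l : Fin (m + 1), s ≤ t l →
      s ∈ ⋃ k : Fin m, Icc (t k.castSucc) (t k.succ) ∨ l = 0 := by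
    intro l
    induction l using Fin.induction with
    | zero => exact fun _ => Or.inr rfl
    | succ k ih =>
      intro hk
      rcases le_total (t k.castSucc) s with h | h
      · exact Or.inl (mem_iUnion.2 ⟨k, h, hk⟩)
      · rcases ih h with h' | h'
        · exact Or.inl h'
        · refine Or.inl (mem_iUnion.2 ⟨k, ?_, hk⟩)
          rw [h', h0]
          exact hs.1
  rcases key (Fin.last m) (h1 ▸ hs.2) with h | h
  · exact h
  · exact absurd (h1.symm.trans ((congrArg t h).trans h0)) one_ne_zero

end PiecewiseLinear

section Embedding

open AffineMap

variable {f : (Fin 6 → ℝ) → (Fin 3 → ℝ)} {m : ℕ} {t : Fin (m + 1) → ℝ}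

/-- The images of the points subdividing the edges of `K₆`. -/
def brokenEdge (f : (Fin 6 → ℝ) → (Fin 3 → ℝ)) (t : Fin (m + 1) → ℝ) (i j : Fin 6)
    (k : Fin (m + 1)) : Fin 3 → ℝ :=
  f (lineMap (vert i) (vert j) (t k))

/-- The `k`-th piece of the image of the edge `i j`. -/
def edgePiece (f : (Fin 6 → ℝ) → (Fin 3 → ℝ)) (t : Fin (m + 1) → ℝ) (i j : Fin 6) (k : Fin m) :
    Set (Fin 3 → ℝ) :=
  segment ℝ (brokenEdge f t i j k.castSucc) (brokenEdge f t i j k.succ)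

/-- The map `f` is affine on each piece of each edge. -/
def IsAffineOnPieces (f : (Fin 6 → ℝ) → (Fin 3 → ℝ)) (t : Fin (m + 1) → ℝ) : Prop :=
  ∀ i j : Fin 6, i ≠ j → ∀ k : Fin m, ∃ g : ℝ →ᵃ[ℝ] (Fin 3 → ℝ),
    EqOn (fun s => f (lineMap (vert i) (vert j) s)) g (Icc (t k.castSucc) (t k.succ))

theorem edgePiece_eq_image (ht : StrictMono t) (hf : IsAffineOnPieces f t) {i j : Fin 6}
    (hij : i ≠ j) (k : Fin m) : edgePiece f t i j k =
      (fun s => f (lineMap (vert i) (vert j) s)) '' Icc (t k.castSucc) (t k.succ) := by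
  obtain ⟨g, hg⟩ := hf i j hij k
  have hle : t k.castSucc ≤ t k.succ := (ht Fin.castSucc_lt_succ).le
  rw [hg.image_eq, ← segment_eq_Icc hle, image_segment, edgePiece,
    ← hg (left_mem_Icc.2 hle), ← hg (right_mem_Icc.2 hle)]
  rfl

theorem image_edge_eq_iUnion (ht : StrictMono t) (h0 : t 0 = 0) (h1 : t (Fin.last m) = 1)
    (hf : IsAffineOnPieces f t) {i j : Fin 6} (hij : i ≠ j) :
    f '' segment ℝ (vert i) (vert j) = ⋃ k : Fin m, edgePiece f t i j k := by
  simp only [edgePiece_eq_image ht hf hij]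
  rw [← image_iUnion, iUnion_Icc_eq ht h0 h1, segment_eq_image_lineMap, image_image]

theorem image_triangleSet_eq_iUnion (ht : StrictMono t) (h0 : t 0 = 0) (h1 : t (Fin.last m) = 1)
    (hf : IsAffineOnPieces f t) {u v w : Fin 6} (huv : u ≠ v) (hvw : v ≠ w) (huw : u ≠ w) :
    f '' triangleSet u v w = ⋃ e ∈ (Finset.univ : Finset (Fin 3 × Fin m)),
      edgePiece f t (triEdge u v w e.1).1 (triEdge u v w e.1).2 e.2 := by
  rw [triangleSet, segment_symm ℝ (vert w), image_union, image_union,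
    image_edge_eq_iUnion ht h0 h1 hf huv, image_edge_eq_iUnion ht h0 h1 hf hvw,
    image_edge_eq_iUnion ht h0 h1 hf huw]
  ext x
  simp [Prod.exists, Fin.exists_fin_succ, triEdge, or_assoc]

theorem exists_lineMap_eq (ht : StrictMono t) (h0 : t 0 = 0) (h1 : t (Fin.last m) = 1)
    (hInj : InjOn f (graphRealization (⊤ : SimpleGraph (Fin 6))))
    (hf : IsAffineOnPieces f t) {i j x y : Fin 6} (hij : i ≠ j) (hxy : x ≠ y) {k l : Fin m}
    {z : Fin 3 → ℝ} (hz : z ∈ edgePiece f t i j k) (hz' : z ∈ edgePiece f t x y l) :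
    ∃ s ∈ Icc (t k.castSucc) (t k.succ), ∃ s' ∈ Icc (t l.castSucc) (t l.succ),
      lineMap (vert i) (vert j) s = (lineMap (vert x) (vert y) s' : Fin 6 → ℝ) ∧
        z = f (lineMap (vert i) (vert j) s) := by
  have hI (k : Fin m) : Icc (t k.castSucc) (t k.succ) ⊆ Icc 0 1 := Icc_subset_Icc
    (h0 ▸ ht.monotone (Fin.zero_le _)) (h1 ▸ ht.monotone (Fin.le_last _))
  rw [edgePiece_eq_image ht hf hij] at hz
  rw [edgePiece_eq_image ht hf hxy] at hz'
  obtain ⟨s, hs, rfl⟩ := hz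
  obtain ⟨s', hs', he⟩ := hz'
  exact ⟨s, hs, s', hs', hInj (lineMap_mem_graphRealization hij (hI k hs))
    (lineMap_mem_graphRealization hxy (hI l hs')) he.symm, rfl⟩

theorem disjoint_edgePiece (ht : StrictMono t) (h0 : t 0 = 0) (h1 : t (Fin.last m) = 1)
    (hInj : InjOn f (graphRealization (⊤ : SimpleGraph (Fin 6))))
    (hf : IsAffineOnPieces f t) {i j x y : Fin 6} (h : [i, j, x, y].Nodup) (k l : Fin m) :
    Disjoint (edgePiece f t i j k) (edgePiece f t x y l) := by
  refine disjoint_left.2 fun z hz hz' => ?_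
  have h' := h
  simp only [List.nodup_cons, List.mem_cons, List.not_mem_nil, not_or, or_false] at h'
  obtain ⟨s, -, s', -, he, -⟩ := exists_lineMap_eq ht h0 h1 hInj hf h'.1.1 h'.2.2.1 hz hz'
  exact lineMap_vert_ne h he

theorem edgePiece_inter_subset (ht : StrictMono t) (h0 : t 0 = 0) (h1 : t (Fin.last m) = 1)
    (hInj : InjOn f (graphRealization (⊤ : SimpleGraph (Fin 6))))
    (hf : IsAffineOnPieces f t) {i j x y : Fin 6} (hij : i < j) (hxy : x < y) {k l : Fin m}
    (hne : (i, j, k) ≠ (x, y, l)) : edgePiece f t i j k ∩ edgePiece f t x y l ⊆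
      {brokenEdge f t i j k.castSucc, brokenEdge f t i j k.succ} := by
  rintro z ⟨hz, hz'⟩
  obtain ⟨s, hs, s', hs', he, rfl⟩ := exists_lineMap_eq ht h0 h1 hInj hf hij.ne hxy.ne hz hz'
  suffices h : s = t k.castSucc ∨ s = t k.succ by
    rcases h with rfl | rfl
    exacts [Or.inl rfl, Or.inr rfl]
  by_cases hxy' : i = x ∧ j = y
  · obtain ⟨rfl, rfl⟩ := hxy'
    obtain rfl := lineMap_vert_injective hij.ne he
    exact mem_Icc_inter_Icc ht (fun h => hne (by rw [h])) hs hs'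
  · obtain ⟨n, rfl⟩ : ∃ n, s = t n := by
      rcases eq_zero_or_one_of_lineMap_vert hij.ne (by omega) he with rfl | rfl
      exacts [⟨0, h0.symm⟩, ⟨Fin.last m, h1.symm⟩]
    rcases mem_endpoints_of_mem_Icc ht hs with rfl | rfl
    exacts [Or.inl rfl, Or.inr rfl]

theorem triEdge_injective {u v w : Fin 6} (huv : u < v) (hvw : v < w) :
    Function.Injective (triEdge u v w) := by
  intro n n' h
  fin_cases n <;> fin_cases n' <;> simp [triEdge] at h ⊢ <;> omega

theorem linkedMod2Curves_of_meetCount (ht : StrictMono t) (h0 : t 0 = 0)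
    (h1 : t (Fin.last m) = 1) (hInj : InjOn f (graphRealization (⊤ : SimpleGraph (Fin 6))))
    (hf : IsAffineOnPieces f t) {u v w x y z : Fin 6} (huv : u < v) (hvw : v < w) (hxy : x < y)
    (hyz : y < z) (hN : [u, v, w, x, y, z].Nodup)
    (hc : ∀ p, IsGenericFor (brokenEdge f t) p → meetCount (brokenEdge f t) p u v w x y z = 1) :
    LinkedMod2Curves (f '' triangleSet u v w) (f '' triangleSet x y z) := by
  have hne {u v w : Fin 6} (huv : u < v) (hvw : v < w) {e e' : Fin 3 × Fin m} (h : e ≠ e') :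
      ((triEdge u v w e.1).1, (triEdge u v w e.1).2, e.2) ≠
        ((triEdge u v w e'.1).1, (triEdge u v w e'.1).2, e'.2) := fun h' => by
    simp only [Prod.mk.injEq] at h'
    exact h (Prod.ext (triEdge_injective huv hvw (Prod.ext h'.1 h'.2.1)) h'.2.2)
  refine (dense_isGenericFor (brokenEdge f t)).mono fun p hp => ?_
  rw [mem_ofPred_eq, image_triangleSet_eq_iUnion ht h0 h1 hf huv.ne hvw.ne (huv.trans hvw).ne,
    image_triangleSet_eq_iUnion ht h0 h1 hf hxy.ne hyz.ne (hxy.trans hyz).ne]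
  obtain ⟨hfin, hcard⟩ := finite_and_ncard_coneFrom_inter (p := p)
    (C := (Finset.univ : Finset (Fin 3 × Fin m))) (C' := (Finset.univ : Finset (Fin 3 × Fin m)))
    (a := fun e => brokenEdge f t (triEdge u v w e.1).1 (triEdge u v w e.1).2 e.2.castSucc)
    (b := fun e => brokenEdge f t (triEdge u v w e.1).1 (triEdge u v w e.1).2 e.2.succ)
    (c := fun e => brokenEdge f t (triEdge x y z e.1).1 (triEdge x y z e.1).2 e.2.castSucc)
    (d := fun e => brokenEdge f t (triEdge x y z e.1).1 (triEdge x y z e.1).2 e.2.succ)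
    (fun e _ f _ => (hp _ _ _ _ _ _).1) (fun e _ e' _ f _ => (hp _ _ _ _ _ _).2 _ _ _)
    (fun e _ f' _ => disjoint_edgePiece ht h0 h1 hInj hf (triEdge_nodup hN _ _) _ _)
    (fun e _ e' _ h => edgePiece_inter_subset ht h0 h1 hInj hf (triEdge_lt huv hvw _)
      (triEdge_lt huv hvw _) (hne huv hvw h))
    (fun e _ e' _ h => edgePiece_inter_subset ht h0 h1 hInj hf (triEdge_lt hxy hyz _)
      (triEdge_lt hxy hyz _) (hne hxy hyz h))
  exact ⟨hfin, ZMod.natCast_eq_one_iff_odd.1 (hcard.trans (hc p hp))⟩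

end Embedding

/-- Conway–Gordon–Sachs: every PL embedding of `K₆` into `ℝ³` contains two vertex-disjoint
3-cycles whose images have odd mod 2 linking number. -/
theorem conway_gordon_sachs (f : (Fin 6 → ℝ) → (Fin 3 → ℝ))
    (hPL : IsPLOn f (graphRealization (⊤ : SimpleGraph (Fin 6))))
    (hInj : InjOn f (graphRealization (⊤ : SimpleGraph (Fin 6)))) :
    ∃ u v w x y z : Fin 6, u ≠ v ∧ u ≠ w ∧ v ≠ w ∧ x ≠ y ∧ x ≠ z ∧ y ≠ z ∧
      ({u, v, w} : Set (Fin 6)) ∩ {x, y, z} = ∅ ∧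
      LinkedMod2Curves (f '' triangleSet u v w) (f '' triangleSet x y z) := by
  obtain ⟨m, hm, t, ht, h0, h1, hf⟩ := exists_affine_subdivision hPL
  obtain ⟨u, v, w, x, y, z, huv, hvw, hxy, hyz, hN, hc⟩ := exists_meetCount_eq_one
    (A := brokenEdge f t) (w := fun i => f (vert i)) hm (by simp [brokenEdge, h0])
    (by simp [brokenEdge, h1]) (fun i j x y h k l => disjoint_edgePiece ht h0 h1 hInj hf h k l)
  refine ⟨u, v, w, x, y, z, huv.ne, (huv.trans hvw).ne, hvw.ne, hxy.ne, (hxy.trans hyz).ne, hyz.ne,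
    ?_, linkedMod2Curves_of_meetCount ht h0 h1 hInj hf huv hvw hxy hyz hN hc⟩
  simp only [List.nodup_cons, List.mem_cons, List.not_mem_nil, not_or, or_false] at hN
  rw [← disjoint_iff_inter_eq_empty]
  simp
  tauto
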